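/- arXiv:2204.04493 — 4 statements merged into one kernel-verified Lean document; each statement's English description precedes it below -/
import Mathlib

section
/- Classification of tight teleportation schemes (necessity direction). Let d ≥ 1. Suppose W ∈ M_d(ℂ)⊗M_d(ℂ) is a state, (F_i)_{i<d²} is a POVM on ℂ^d⊗ℂ^d (each F_i positive semidefinite and ∑_{i<d²} F_i = I), and (T_i)_{i<d²} are channels M_d(ℂ) → M_d(ℂ), such that the teleportation equation ∑_{i<d²} T_i( Tr_{1,2}[ (F_i ⊗ I_d)(ρ ⊗ W) ] ) = ρ holds for every ρ ∈ M_d(ℂ). Then: (1) W = |w⟩⟨w| for a maximally entangled unit vector w ∈ ℂ^d⊗ℂ^d; (2) there is a unitary error basis (U_i)_{i<d²} on ℂ^d such that F_i = |Φ_i⟩⟨Φ_i| where Φ_i := (U_i⊗I_d)w; and (3) there are unitaries (V_i)_{i<d²} in M_d(ℂ) such that Tr_{1,2}[(F_i⊗I_d)(ρ⊗W)] = (1/d²)·V_i ρ V_i† and T_i(σ) = V_i† σ V_i for all ρ, σ ∈ M_d(ℂ). -/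
noncomputable section

open Matrix Kronecker
open scoped ComplexOrder

namespace EntInvPaper

/-- The matrix algebra `M_n(ℂ)` with row/column index type `n`. -/
abbrev Mat (n : Type) : Type := Matrix n n ℂ

/-- The amplification `id_{M_t} ⊗ Φ` of a linear map between matrix algebras,
as a plain function on matrices. -/
def amplL {n m : Type} (t : Type) (Φ : Mat n →ₗ[ℂ] Mat m) (X : Mat (t × n)) : Mat (t × m) :=
  Matrix.of fun p q => Φ (Matrix.of fun x y => X (p.1, x) (q.1, y)) p.2 q.2

/-- The amplification `Φ ⊗ id_{M_t}` of a linear map between matrix algebras. -/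
def amplR {n m : Type} (t : Type) (Φ : Mat n →ₗ[ℂ] Mat m) (X : Mat (n × t)) : Mat (m × t) :=
  Matrix.of fun p q => Φ (Matrix.of fun x y => X (x, p.2) (y, q.2)) p.1 q.1

/-- Complete positivity: every amplification `id_{M_k} ⊗ Φ` preserves positive
semidefiniteness. -/
def IsCP {n m : Type} [Fintype n] [Fintype m] (Φ : Mat n →ₗ[ℂ] Mat m) : Prop :=
  ∀ (k : ℕ) (X : Mat (Fin k × n)), X.PosSemidef → (amplL (Fin k) Φ X).PosSemidef

/-- A channel is a completely positive trace-preserving linear map. -/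
def IsChannel {n m : Type} [Fintype n] [Fintype m] (Φ : Mat n →ₗ[ℂ] Mat m) : Prop :=
  IsCP Φ ∧ ∀ X : Mat n, (Φ X).trace = X.trace

/-- A state: a positive semidefinite matrix of trace one. -/
def IsState {n : Type} [Fintype n] (ρ : Mat n) : Prop :=
  ρ.PosSemidef ∧ ρ.trace = 1

/-- The outer product `|v⟩⟨v|`. -/
def outer {n : Type} (v : n → ℂ) : Mat n :=
  Matrix.vecMulVec v (star v)

/-- `x ⊗ W`, with the tensor factors regrouped as `(a × h₁) × h₂`. -/
def tensorState {a h₁ h₂ : Type} (x : Mat a) (W : Mat (h₁ × h₂)) : Mat ((a × h₁) × h₂) :=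
  Matrix.reindex (Equiv.prodAssoc a h₁ h₂).symm (Equiv.prodAssoc a h₁ h₂).symm (x ⊗ₖ W)

/-- Swap the two tensor factors of a bipartite operator. -/
def swapState {h₁ h₂ : Type} (W : Mat (h₁ × h₂)) : Mat (h₂ × h₁) :=
  Matrix.reindex (Equiv.prodComm h₁ h₂) (Equiv.prodComm h₁ h₂) W

/-- Partial trace over the first tensor factor. -/
def ptraceFst {p t : Type} [Fintype p] (X : Mat (p × t)) : Mat t :=
  Matrix.of fun s s' => ∑ u : p, X (u, s) (u, s')

/-- Partial trace over the second tensor factor. -/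
def ptraceSnd {s t : Type} [Fintype t] (X : Mat (s × t)) : Mat s :=
  Matrix.of fun i i' => ∑ k : t, X (i, k) (i', k)

/-- `N` is an entanglement-left inverse of `M` with respect to the resource state `W`:
`N((M ⊗ id)(x ⊗ W)) = x` for all `x`. -/
def EntLeftInv {a b h₁ h₂ : Type} (M : Mat (a × h₁) →ₗ[ℂ] Mat b)
    (N : Mat (b × h₂) →ₗ[ℂ] Mat a) (W : Mat (h₁ × h₂)) : Prop :=
  ∀ x : Mat a, N (amplR h₂ M (tensorState x W)) = x

/-- `N` is an entanglement-right inverse of `M` with respect to `W`: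
`M((N ⊗ id)(y ⊗ Wᵠ)) = y` for all `y`, where `Wᵠ` is `W` with the factors swapped. -/
def EntRightInv {a b h₁ h₂ : Type} (M : Mat (a × h₁) →ₗ[ℂ] Mat b)
    (N : Mat (b × h₂) →ₗ[ℂ] Mat a) (W : Mat (h₁ × h₂)) : Prop :=
  ∀ y : Mat b, M (amplR h₁ N (tensorState y (swapState W))) = y

/-- `M` is entanglement-reversible with respect to `W`. -/
def EntReversible {a b h₁ h₂ : Type} [Fintype a] [Fintype b] [Fintype h₁] [Fintype h₂]
    (M : Mat (a × h₁) →ₗ[ℂ] Mat b) (W : Mat (h₁ × h₂)) : Prop :=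
  ∃ N : Mat (b × h₂) →ₗ[ℂ] Mat a, IsChannel N ∧ EntLeftInv M N W

/-- `M` is entanglement-invertible with respect to `W`. -/
def EntInvertible {a b h₁ h₂ : Type} [Fintype a] [Fintype b] [Fintype h₁] [Fintype h₂]
    (M : Mat (a × h₁) →ₗ[ℂ] Mat b) (W : Mat (h₁ × h₂)) : Prop :=
  ∃ N : Mat (b × h₂) →ₗ[ℂ] Mat a, IsChannel N ∧ EntLeftInv M N W ∧ EntRightInv M N W

/-- The canonical maximally entangled unit vector `Ω = (1/√h) ∑ₖ eₖ ⊗ eₖ`. -/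
def omegaVec (h : ℕ) : Fin h × Fin h → ℂ :=
  fun p => if p.1 = p.2 then ((Real.sqrt h : ℝ) : ℂ)⁻¹ else 0

/-- The canonical maximally entangled state `|Ω⟩⟨Ω|`. -/
def canME (h : ℕ) : Mat (Fin h × Fin h) := outer (omegaVec h)

/-- The vector `w_ω = ∑ₖ eₖ ⊗ ω eₖ` associated to a linear map `ω : ℂ^{h₁} → ℂ^{h₂}`. -/
def pureVec {h₁ h₂ : Type} (ω : Matrix h₂ h₁ ℂ) : h₁ × h₂ → ℂ := fun p => ω p.2 p.1

/-- The pure state `|w_ω⟩⟨w_ω|` defined by `ω`. -/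
def pureState {h₁ h₂ : Type} (ω : Matrix h₂ h₁ ℂ) : Mat (h₁ × h₂) := outer (pureVec ω)

/-- `V` is a Stinespring dilation of the channel `M`, with environment the second
tensor factor `ℂ^e`: `V` is an isometry and `M z = Tr_{ℂ^e}(V z V†)`. -/
def IsDilation {a h b e : ℕ} (M : Mat (Fin a × Fin h) →ₗ[ℂ] Mat (Fin b))
    (V : Matrix (Fin b × Fin e) (Fin a × Fin h) ℂ) : Prop :=
  Vᴴ * V = 1 ∧ ∀ z : Mat (Fin a × Fin h), M z = ptraceSnd (V * z * Vᴴ)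

/-- Minimality of a dilation: the vectors `(⟨y| ⊗ I)Vξ` span the environment. -/
def IsMinimalDilation {a h b e : ℕ} (V : Matrix (Fin b × Fin e) (Fin a × Fin h) ℂ) : Prop :=
  Submodule.span ℂ { v : Fin e → ℂ |
    ∃ (y : Fin b → ℂ) (ξ : Fin a × Fin h → ℂ),
      v = fun f => ∑ j, (starRingEnd ℂ) (y j) * (V *ᵥ ξ) (j, f) } = ⊤

/-- The rearrangement `Ṽ` of `V : ℂ^a ⊗ ℂ^h → ℂ^b ⊗ ℂ^e`, with entries
`Ṽ_{(k,j),(i,f)} = V_{(j,f),(i,k)}`. -/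
def rearrange {a b h e : ℕ} (V : Matrix (Fin b × Fin e) (Fin a × Fin h) ℂ) :
    Matrix (Fin h × Fin b) (Fin a × Fin e) ℂ :=
  Matrix.of fun p q => V (p.2, q.2) (q.1, p.1)

/-- The candidate bi-isometry `S = (ω ⊗ I_b) · Ṽ · (I_a ⊗ κ)`. -/
def biIsometryCandidate {a b h e : ℕ} (ω : Mat (Fin h))
    (V : Matrix (Fin b × Fin e) (Fin a × Fin h) ℂ) (κ : Mat (Fin e)) :
    Matrix (Fin h × Fin b) (Fin a × Fin e) ℂ :=
  (ω ⊗ₖ (1 : Mat (Fin b))) * rearrange V * ((1 : Mat (Fin a)) ⊗ₖ κ)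

/-- The contraction `(⟨Φ| ⊗ I)X(|Φ⟩ ⊗ I)` of the first tensor factor of `X`
against the vector `Φ`. -/
def contract {p t : Type} [Fintype p] (Φ : p → ℂ) (X : Mat (p × t)) : Mat t :=
  Matrix.of fun s s' => ∑ u : p, ∑ u' : p, (starRingEnd ℂ) (Φ u) * X (u, s) (u', s') * Φ u'

/-- Conjugation `X ↦ C X C†` as a linear map. -/
def conjBy {p q : Type} [Fintype q] (C : Matrix p q ℂ) : Mat q →ₗ[ℂ] Mat p where
  toFun X := C * X * Cᴴ
  map_add' X Y := by
    show C * (X + Y) * Cᴴ = C * X * Cᴴ + C * Y * Cᴴ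
    rw [Matrix.mul_add, Matrix.add_mul]
  map_smul' c X := by
    show C * (c • X) * Cᴴ = c • (C * X * Cᴴ)
    rw [Matrix.mul_smul, Matrix.smul_mul]

end EntInvPaper

noncomputable section
open Matrix Kronecker
open scoped ComplexOrder
namespace EntInvPaper

/-- The vector of `ℂ^m ⊗ ℂ^n` with coefficient matrix `A`. -/
def flat {m n : Type} (A : Matrix m n ℂ) : m × n → ℂ := fun p => A p.1 p.2

lemma outer_smul {n : Type} (c : ℂ) (v : n → ℂ) :
    outer (c • v) = (c * star c) • outer v := by
  ext x y
  simp only [outer, vecMulVec_apply, Pi.smul_apply, Pi.star_apply, smul_eq_mul, star_mul',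
    Matrix.smul_apply]
  ring

lemma outer_zero {n : Type} : outer (0 : n → ℂ) = 0 := by
  ext x y
  simp [outer, vecMulVec_apply]

lemma trace_outer {n : Type} [Fintype n] (v : n → ℂ) : (outer v).trace = star v ⬝ᵥ v := by
  simp [outer, Matrix.trace, vecMulVec_apply, dotProduct, mul_comm]

lemma posSemidef_outer {n : Type} [Fintype n] (v : n → ℂ) : (outer v).PosSemidef :=
  posSemidef_vecMulVec_self_star v

/-- A finite sum `∑ |cⱼ|²` is of the form `|r|²`. -/
lemma exists_mul_star_eq_sum {ι : Type} [Fintype ι] (c : ι → ℂ) :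
    ∃ r : ℂ, r * star r = ∑ j, c j * star (c j) := by
  refine ⟨(Real.sqrt (∑ j, ‖c j‖ ^ 2) : ℝ), ?_⟩
  have h : 0 ≤ ∑ j, ‖c j‖ ^ 2 := Finset.sum_nonneg fun j _ => by positivity
  have hc : ∀ j, c j * star (c j) = ((‖c j‖ ^ 2 : ℝ) : ℂ) := fun j => by
    rw [Complex.star_def, Complex.mul_conj, Complex.normSq_eq_norm_sq]
  rw [Finset.sum_congr rfl fun j _ => hc j, ← Complex.ofReal_sum, Complex.star_def,
    Complex.conj_ofReal, ← Complex.ofReal_mul, Real.mul_self_sqrt h]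

lemma mul_star_sum_eq_zero {ι : Type} [Fintype ι] {c : ι → ℂ}
    (h : ∑ j, c j * star (c j) = 0) (j : ι) : c j = 0 := by
  have := (Finset.sum_eq_zero_iff_of_nonneg fun j _ => mul_star_self_nonneg (c j)).1 h j
    (Finset.mem_univ j)
  simpa using this

open scoped MatrixOrder in
/-- A positive semidefinite matrix is a sum of outer products. -/
lemma exists_sum_outer {n : Type} [Fintype n] {F : Mat n} (hF : F.PosSemidef) :
    ∃ v : n → n → ℂ, F = ∑ b, outer (v b) := by
  classical
  obtain ⟨B, rfl⟩ := CStarAlgebra.nonneg_iff_eq_star_mul_self.mp hF.nonneg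
  refine ⟨fun b => star (B b), ?_⟩
  ext x y
  simp [outer, Matrix.sum_apply, vecMulVec_apply, Matrix.mul_apply, star_eq_conjTranspose]

/-- A completely positive map has a Kraus decomposition. -/
lemma IsCP.exists_kraus {d : ℕ} {T : Mat (Fin d) →ₗ[ℂ] Mat (Fin d)} (hT : IsCP T) :
    ∃ K : Fin d × Fin d → Mat (Fin d), ∀ σ, T σ = ∑ γ, K γ * σ * (K γ)ᴴ := by
  obtain ⟨v, hv⟩ := exists_sum_outer (hT d _ (posSemidef_outer (flat (1 : Mat (Fin d)))))
  refine ⟨fun γ => of fun s k => v γ (k, s), fun σ => ?_⟩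
  have hchoi : ∀ k l s t, T (Matrix.single k l 1) s t = ∑ γ, v γ (k, s) * star (v γ (l, t)) := by
    intro k l s t
    have h := congrFun₂ hv (k, s) (l, t)
    have hE : (of fun x y => outer (flat (1 : Mat (Fin d))) (k, x) (l, y))
        = Matrix.single k l (1 : ℂ) := by
      ext x y
      simp only [outer, flat, vecMulVec_apply, of_apply, Pi.star_apply, Matrix.one_apply,
        Matrix.single_apply]
      split_ifs <;> simp_all
    simp only [amplL, of_apply, hE] at h
    rw [h]
    simp [outer, Matrix.sum_apply, vecMulVec_apply]
  ext s t
  have hσ : T σ = ∑ k, ∑ l, σ k l • T (Matrix.single k l 1) := by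
    conv_lhs => rw [matrix_eq_sum_single σ]
    simp only [map_sum, ← map_smul, smul_single, smul_eq_mul, mul_one]
  simp only [hσ, Matrix.sum_apply, Matrix.smul_apply, hchoi, Matrix.mul_apply, of_apply,
    conjTranspose_apply, smul_eq_mul, Finset.mul_sum, Finset.sum_mul]
  rw [Finset.sum_comm]
  rw [Finset.sum_congr rfl fun l _ => Finset.sum_comm, Finset.sum_comm]
  refine Finset.sum_congr rfl fun γ _ => Finset.sum_congr rfl fun l _ =>
    Finset.sum_congr rfl fun k _ => by ring

/-- The Kraus operators of a trace-preserving map satisfy `∑ K†K = 1`. -/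
lemma sum_conjTranspose_mul_eq_one {n ι : Type} [Fintype n] [DecidableEq n] [Fintype ι]
    {K : ι → Mat n} (h : ∀ X, (∑ γ, K γ * X * (K γ)ᴴ).trace = X.trace) :
    ∑ γ, (K γ)ᴴ * K γ = 1 := by
  refine Matrix.ext_iff_trace_mul_right.2 fun X => ?_
  rw [Matrix.one_mul, ← h X, Finset.sum_mul, trace_sum, trace_sum]
  refine Finset.sum_congr rfl fun γ _ => ?_
  rw [Matrix.mul_assoc, trace_mul_comm]

/-- All Kraus operators of the identity channel are scalar. -/
lemma kraus_identity_scalar {n ι : Type} [Fintype n] [DecidableEq n] [Fintype ι]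
    {A : ι → Mat n} (h : ∀ ρ, ∑ j, A j * ρ * (A j)ᴴ = ρ) (j : ι) :
    ∃ c : ℂ, A j = c • (1 : Mat n) := by
  have hE : ∀ k l s t, ∑ j, A j s k * star (A j t l) = Matrix.single k l (1 : ℂ) s t := by
    intro k l s t
    rw [← congrFun₂ (h (Matrix.single k l 1)) s t, Matrix.sum_apply]
    refine Finset.sum_congr rfl fun j _ => ?_
    simp [Matrix.mul_apply, Matrix.single_apply, ite_and]
  have hoff : ∀ s k, s ≠ k → A j s k = 0 := fun s k hsk => by
    refine mul_star_sum_eq_zero (c := fun j => A j s k) ?_ j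
    rw [hE]
    simp [hsk.symm]
  have hdiag : ∀ k l, A j k k = A j l l := fun k l => by
    refine sub_eq_zero.1 (mul_star_sum_eq_zero (c := fun j => A j k k - A j l l) ?_ j)
    simp only [star_sub, sub_mul, mul_sub, Finset.sum_sub_distrib, hE]
    simp
  rcases isEmpty_or_nonempty n with hn | ⟨⟨k⟩⟩
  · exact ⟨0, Subsingleton.elim _ _⟩
  · refine ⟨A j k k, ?_⟩
    ext s t
    by_cases hst : s = t
    · subst hst; simpa using hdiag s k
    · simp [hoff s t hst, hst]

/-- Measuring a pure effect on the input and half of a pure resource acts by conjugation. -/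
lemma ptraceFst_pure {d : ℕ} (ω φ ρ : Mat (Fin d)) :
    ptraceFst ((outer (flat φ) ⊗ₖ (1 : Mat (Fin d))) * tensorState ρ (pureState ω))
      = (ω * φᴴ) * ρ * (ω * φᴴ)ᴴ := by
  ext s t
  simp only [ptraceFst, of_apply, Matrix.mul_apply, kroneckerMap_apply, Matrix.one_apply,
    tensorState, reindex_apply, submatrix_apply, Fintype.sum_prod_type, Equiv.symm_symm,
    Equiv.prodAssoc_apply, pureState, pureVec, outer, flat, vecMulVec_apply, Pi.star_apply,
    conjTranspose_apply, mul_ite, mul_one, mul_zero, ite_mul, zero_mul, Finset.sum_ite_eq,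
    Finset.mem_univ, if_true, star_sum, star_mul', star_star, Finset.sum_mul, Finset.mul_sum]
  exact Finset.sum_congr rfl fun _ _ => Finset.sum_congr rfl fun _ _ =>
    Finset.sum_congr rfl fun _ _ => Finset.sum_congr rfl fun _ _ => by ring

/-- The Kraus form of the map `ρ ↦ Tr₁₂[(F ⊗ I)(ρ ⊗ W)]`. -/
lemma ptraceFst_sum {d : ℕ} {ι κ : Type} [Fintype ι] [Fintype κ] (ω : ι → Mat (Fin d))
    (φ : κ → Mat (Fin d)) (ρ : Mat (Fin d)) :
    ptraceFst (((∑ b, outer (flat (φ b))) ⊗ₖ (1 : Mat (Fin d))) *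
        tensorState ρ (∑ a, pureState (ω a)))
      = ∑ a, ∑ b, (ω a * (φ b)ᴴ) * ρ * (ω a * (φ b)ᴴ)ᴴ := by
  simp only [← ptraceFst_pure]
  ext s t
  simp only [ptraceFst, of_apply, Matrix.mul_apply, kroneckerMap_apply, tensorState,
    reindex_apply, submatrix_apply, Matrix.sum_apply, Finset.sum_mul, Finset.mul_sum]
  rw [Finset.sum_congr rfl fun _ _ => Finset.sum_comm, Finset.sum_comm]
  refine Finset.sum_congr rfl fun a _ => ?_
  rw [Finset.sum_congr rfl fun _ _ => Finset.sum_comm, Finset.sum_comm]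

lemma flat_smul {m n : Type} (c : ℂ) (A : Matrix m n ℂ) : flat (c • A) = c • flat A := rfl

lemma flat_zero {m n : Type} : flat (0 : Matrix m n ℂ) = 0 := rfl

/-- A sum of outer products of multiples of one vector is a single outer product. -/
lemma exists_sum_outer_smul {n ι : Type} [Fintype ι] (g : ι → ℂ) (v : n → ℂ) :
    ∃ r : ℂ, ∑ b, outer (g b • v) = outer (r • v) := by
  obtain ⟨r, hr⟩ := exists_mul_star_eq_sum g
  exact ⟨r, by simp only [outer_smul, hr, Finset.sum_smul]⟩

/-- A resolution of the identity into `d²` rank-one operators is orthonormal. -/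
lemma trace_conjTranspose_mul_of_sum_outer {d : ℕ} {ψ : Fin (d ^ 2) → Mat (Fin d)}
    (h : ∑ i, outer (flat (ψ i)) = 1) (i j : Fin (d ^ 2)) :
    ((ψ i)ᴴ * ψ j).trace = if i = j then 1 else 0 := by
  let Ψ : Matrix (Fin d × Fin d) (Fin (d ^ 2)) ℂ := of fun p i => flat (ψ i) p
  have hΨ : Ψ * Ψᴴ = 1 := by
    rw [← h]
    ext p q
    simp [Ψ, Matrix.mul_apply, Matrix.sum_apply, outer, vecMulVec_apply]
  have hcard : Fintype.card (Fin d × Fin d) = Fintype.card (Fin (d ^ 2)) := by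
    simp [sq]
  have := congrFun₂ ((mul_eq_one_comm_of_card_eq _ _ _ hcard).1 hΨ) i j
  rw [Matrix.one_apply] at this
  rw [← this]
  simp only [Ψ, flat, Matrix.trace, Matrix.mul_apply, Matrix.diag_apply, conjTranspose_apply,
    of_apply, Fintype.sum_prod_type]
  exact Finset.sum_comm

lemma sum_conjTranspose_mul_of_sum_outer {d : ℕ} {ι : Type} [Fintype ι] {ψ : ι → Mat (Fin d)}
    (h : ∑ i, outer (flat (ψ i)) = 1) :
    ∑ i, (ψ i)ᴴ * ψ i = (d : ℂ) • (1 : Mat (Fin d)) := by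
  ext x y
  have hxy : ∀ a, ∑ i, ψ i a y * star (ψ i a x) = (1 : Mat (Fin d)) y x := fun a => by
    have := congrFun₂ h (a, y) (a, x)
    simpa [Matrix.sum_apply, outer, flat, vecMulVec_apply, Matrix.one_apply] using this
  simp only [Matrix.sum_apply, Matrix.mul_apply, conjTranspose_apply, Matrix.smul_apply]
  rw [Finset.sum_comm]
  simp only [mul_comm (star _), hxy]
  simp [Matrix.one_apply, eq_comm]

/-- If all products `K γ * ω α * (φ β)ᴴ` are scalar, where the `K γ` are the Kraus operators of a
channel, some `ω α₀` is invertible and the `φ β` do not all vanish, then the channel is unitary,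
the `ω α` are proportional, and the effect `∑ |φ β⟩⟨φ β|` has rank one. -/
lemma unitary_of_scalar_products {n ι κ μ : Type} [Fintype n] [DecidableEq n] [Fintype ι]
    [Fintype κ] {K : κ → Mat n} (hK : ∑ γ, (K γ)ᴴ * K γ = 1) {ω : μ → Mat n} {φ : ι → Mat n}
    (hs : ∀ α β γ, ∃ c : ℂ, K γ * (ω α * (φ β)ᴴ) = c • (1 : Mat n))
    {α₀ : μ} {Ω : Mat n} (hΩ : Ω * ω α₀ = 1) {β₁ : ι} (hβ₁ : φ β₁ ≠ 0) :
    ∃ V ∈ Matrix.unitaryGroup n ℂ, (∀ σ, ∑ γ, K γ * σ * (K γ)ᴴ = Vᴴ * σ * V) ∧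
      (∀ α, ∃ b : ℂ, ω α = b • ω α₀) ∧
      ∃ (ψ : Mat n) (f : ℂ), ∑ β, outer (flat (φ β)) = outer (flat ψ) ∧ ω α₀ * ψᴴ = f • V := by
  choose c hc using hs
  obtain ⟨γ₁, hγ₁⟩ : ∃ γ₁, c α₀ β₁ γ₁ ≠ 0 := by
    by_contra! h0
    refine hβ₁ ?_
    have h1 : ω α₀ * (φ β₁)ᴴ = 0 := by
      rw [← Matrix.one_mul (ω α₀ * _), ← hK, Finset.sum_mul]
      refine Finset.sum_eq_zero fun γ _ => ?_
      rw [Matrix.mul_assoc, hc, h0, zero_smul, Matrix.mul_zero]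
    have h2 : (φ β₁)ᴴ = 0 := by
      rw [← Matrix.one_mul (φ β₁)ᴴ, ← hΩ, Matrix.mul_assoc, h1, Matrix.mul_zero]
    exact conjTranspose_eq_zero.1 h2
  set c₁ := c α₀ β₁ γ₁
  obtain ⟨P, hP⟩ : ∃ P : Mat n, P = c₁⁻¹ • (ω α₀ * (φ β₁)ᴴ) := ⟨_, rfl⟩
  have hKP : K γ₁ * P = 1 := by
    rw [hP, Matrix.mul_smul, hc, smul_smul, inv_mul_cancel₀ hγ₁, one_smul]
  have hPK : P * K γ₁ = 1 := mul_eq_one_comm.1 hKP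
  have hprop : ∀ γ, K γ = (c₁⁻¹ * c α₀ β₁ γ) • K γ₁ := fun γ => by
    calc K γ = K γ * (P * K γ₁) := by rw [hPK, Matrix.mul_one]
      _ = (K γ * P) * K γ₁ := (Matrix.mul_assoc _ _ _).symm
      _ = _ := by
        rw [hP, Matrix.mul_smul, hc, smul_smul, Matrix.smul_mul, Matrix.one_mul]
  obtain ⟨r, hr⟩ := exists_mul_star_eq_sum fun γ => c₁⁻¹ * c α₀ β₁ γ
  have hcancel : ∀ (M : Mat n) (x : ℂ), K γ₁ * M = x • (1 : Mat n) → M = x • P := fun M x h => by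
    rw [← Matrix.one_mul M, ← hPK, Matrix.mul_assoc, h, Matrix.mul_smul, Matrix.mul_one]
  obtain ⟨V, hV⟩ : ∃ V : Mat n, V = (r • K γ₁)ᴴ := ⟨_, rfl⟩
  have hVV : V * Vᴴ = 1 := by
    rw [← hK, Finset.sum_congr rfl fun γ _ => by rw [hprop γ]]
    simp only [hV, conjTranspose_smul, conjTranspose_conjTranspose, Matrix.smul_mul,
      Matrix.mul_smul, smul_smul, ← Finset.sum_smul]
    congr 1
    rw [star_star, ← hr, mul_comm]
  have hVV' : Vᴴ * V = 1 := mul_eq_one_comm.1 hVV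
  have hPV : P = r • V := by
    calc P = P * (Vᴴ * V) := by rw [hVV', Matrix.mul_one]
      _ = r • ((P * K γ₁) * V) := by
        have hV' : Vᴴ = r • K γ₁ := by rw [hV, conjTranspose_conjTranspose]
        rw [hV', Matrix.smul_mul, Matrix.mul_smul, Matrix.mul_assoc]
      _ = r • V := by rw [hPK, Matrix.one_mul]
  refine ⟨V, mem_unitaryGroup_iff.2 hVV, fun σ => ?_, fun α => ?_, ?_⟩
  · rw [Finset.sum_congr rfl fun γ _ => by rw [hprop γ]]
    simp only [hV, conjTranspose_smul, conjTranspose_conjTranspose, Matrix.smul_mul,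
      Matrix.mul_smul, smul_smul, ← Finset.sum_smul]
    congr 1
    rw [star_star, mul_comm (star r), hr]
    exact Finset.sum_congr rfl fun _ _ => mul_comm _ _
  · have hX : ω α₀ * (c₁⁻¹ • ((φ β₁)ᴴ * K γ₁)) = 1 := by
      rw [Matrix.mul_smul, ← Matrix.mul_assoc, ← Matrix.smul_mul, ← hP, hPK]
    have hX' := mul_eq_one_comm.1 hX
    refine ⟨c₁⁻¹ * c α β₁ γ₁, ?_⟩
    calc ω α = ω α * ((c₁⁻¹ • ((φ β₁)ᴴ * K γ₁)) * ω α₀) := by rw [hX', Matrix.mul_one]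
      _ = c₁⁻¹ • ((ω α * (φ β₁)ᴴ) * K γ₁ * ω α₀) := by
        simp only [Matrix.smul_mul, Matrix.mul_smul, Matrix.mul_assoc]
      _ = _ := by
        rw [hcancel _ _ (hc α β₁ γ₁), Matrix.smul_mul, hPK, Matrix.smul_mul, Matrix.one_mul,
          smul_smul]
  · have hφ : ∀ β, φ β = star (c α₀ β γ₁ * r) • (Ω * V)ᴴ := fun β => by
      have h1 : (φ β)ᴴ = (c α₀ β γ₁ * r) • (Ω * V) := by
        rw [← Matrix.one_mul (φ β)ᴴ, ← hΩ, Matrix.mul_assoc, hcancel _ _ (hc α₀ β γ₁), hPV,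
          smul_smul, Matrix.mul_smul]
      rw [← conjTranspose_smul, ← h1, conjTranspose_conjTranspose]
    obtain ⟨t, ht⟩ := exists_sum_outer_smul (fun β => star (c α₀ β γ₁ * r)) (flat (Ω * V)ᴴ)
    refine ⟨t • (Ω * V)ᴴ, star t, ?_, ?_⟩
    · rw [flat_smul, ← ht]
      exact Finset.sum_congr rfl fun β _ => by rw [hφ β, flat_smul]
    · rw [conjTranspose_smul, conjTranspose_conjTranspose, Matrix.mul_smul, ← Matrix.mul_assoc,
        mul_eq_one_comm.1 hΩ, Matrix.one_mul]

/-- A pure resource `ω` together with rank-one effects `ψ i` such that `ω * (ψ i)ᴴ` is a multiple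
of a unitary `V i` is maximally entangled, and so are the effects. -/
lemma maximally_entangled_of_mul_eq_smul {d : ℕ} (hd : 1 ≤ d) {ω : Mat (Fin d)}
    (hω : (ω * ωᴴ).trace = 1) {ψ V : Fin (d ^ 2) → Mat (Fin d)} {f : Fin (d ^ 2) → ℂ}
    (hψ : ∑ i, outer (flat (ψ i)) = 1) (hV : ∀ i, V i * (V i)ᴴ = 1)
    (hf : ∀ i, ω * (ψ i)ᴴ = f i • V i) :
    ω * ωᴴ = (d : ℂ)⁻¹ • (1 : Mat (Fin d)) ∧ (∀ i, f i * star (f i) = ((d : ℂ) ^ 2)⁻¹) ∧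
      ∀ i, (ψ i)ᴴ * ψ i = (d : ℂ)⁻¹ • (1 : Mat (Fin d)) := by
  have hd0 : (d : ℂ) ≠ 0 := by exact_mod_cast (by omega : d ≠ 0)
  obtain ⟨s, hs⟩ : ∃ s : ℂ, ω * ωᴴ = s • (1 : Mat (Fin d)) := by
    refine ⟨(d : ℂ)⁻¹ * ∑ i, f i * star (f i), ?_⟩
    have h1 : (d : ℂ) • (ω * ωᴴ) = (∑ i, f i * star (f i)) • (1 : Mat (Fin d)) := by
      calc (d : ℂ) • (ω * ωᴴ) = ω * (∑ i, (ψ i)ᴴ * ψ i) * ωᴴ := by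
            rw [sum_conjTranspose_mul_of_sum_outer hψ, Matrix.mul_smul, Matrix.mul_one,
              Matrix.smul_mul]
        _ = ∑ i, (ω * (ψ i)ᴴ) * (ω * (ψ i)ᴴ)ᴴ := by
            simp only [Finset.mul_sum, Finset.sum_mul, conjTranspose_mul,
              conjTranspose_conjTranspose, Matrix.mul_assoc]
        _ = _ := by
            rw [Finset.sum_smul]
            refine Finset.sum_congr rfl fun i _ => ?_
            rw [hf, conjTranspose_smul, Matrix.smul_mul, Matrix.mul_smul, hV, smul_smul]
    rw [mul_smul, ← h1, smul_smul, inv_mul_cancel₀ hd0, one_smul]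
  have hωω : ω * ωᴴ = (d : ℂ)⁻¹ • (1 : Mat (Fin d)) := by
    rw [hs, trace_smul, trace_one, Fintype.card_fin, smul_eq_mul] at hω
    rw [hs, eq_inv_of_mul_eq_one_left hω]
  have hωω' : ωᴴ * ω = (d : ℂ)⁻¹ • (1 : Mat (Fin d)) := by
    have h1 : ω * ((d : ℂ) • ωᴴ) = 1 := by
      rw [Matrix.mul_smul, hωω, smul_smul, mul_inv_cancel₀ hd0, one_smul]
    have h2 := mul_eq_one_comm.1 h1
    rw [← h2, Matrix.smul_mul, smul_smul, inv_mul_cancel₀ hd0, one_smul]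
  have hψψ : ∀ i, (ψ i)ᴴ * ψ i = (d * (f i * star (f i))) • (1 : Mat (Fin d)) := fun i => by
    have h1 : (ψ i)ᴴ = (d * f i) • (ωᴴ * V i) := by
      rw [mul_smul, ← Matrix.mul_smul, ← hf, ← Matrix.mul_assoc, hωω', Matrix.smul_mul,
        Matrix.one_mul, smul_smul, mul_inv_cancel₀ hd0, one_smul]
    have h2 : ψ i = (d * star (f i)) • ((V i)ᴴ * ω) := by
      rw [← conjTranspose_conjTranspose (ψ i), h1, conjTranspose_smul, conjTranspose_mul,
        conjTranspose_conjTranspose, star_mul']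
      simp
    calc (ψ i)ᴴ * ψ i = (d * f i * (d * star (f i))) • (ωᴴ * (V i * (V i)ᴴ) * ω) := by
          rw [h1, h2, Matrix.smul_mul, Matrix.mul_smul, smul_smul]
          simp only [Matrix.mul_assoc]
      _ = _ := by
          rw [hV, Matrix.mul_one, hωω', smul_smul]
          congr 1
          field_simp
  have hff : ∀ i, f i * star (f i) = ((d : ℂ) ^ 2)⁻¹ := fun i => by
    have h1 := trace_conjTranspose_mul_of_sum_outer hψ i i
    rw [hψψ, if_pos rfl, trace_smul, trace_one, Fintype.card_fin, smul_eq_mul] at h1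
    refine eq_inv_of_mul_eq_one_left ?_
    rw [← h1]
    ring
  refine ⟨hωω, hff, fun i => ?_⟩
  rw [hψψ, hff]
  congr 1
  field_simp

lemma trace_pureState {m n : Type} [Fintype m] [Fintype n] (ω : Matrix m n ℂ) :
    (pureState ω).trace = (ω * ωᴴ).trace := by
  simp only [pureState, outer, pureVec, Matrix.trace, Matrix.diag_apply, vecMulVec_apply,
    Matrix.mul_apply, Fintype.sum_prod_type, conjTranspose_apply, Pi.star_apply]
  exact Finset.sum_comm

lemma kronecker_one_mulVec_pureVec {d : ℕ} (U ω : Mat (Fin d)) :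
    (U ⊗ₖ (1 : Mat (Fin d))) *ᵥ pureVec ω = flat (U * ωᵀ) := by
  ext ⟨x, y⟩
  simp [mulVec, dotProduct, pureVec, flat, Matrix.mul_apply, Fintype.sum_prod_type,
    Matrix.one_apply]

/-- In a tight teleportation scheme the resource is pure, the effects have rank one, the
corrections are unitary, and each product of the resource with an effect is a multiple of the
inverse correction. -/
lemma exists_pure_form {d : ℕ} (hd : 1 ≤ d) {W : Mat (Fin d × Fin d)} (hW : W.PosSemidef)
    {F : Fin (d ^ 2) → Mat (Fin d × Fin d)} (hFpos : ∀ i, (F i).PosSemidef)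
    (hFsum : ∑ i, F i = 1) {T : Fin (d ^ 2) → (Mat (Fin d) →ₗ[ℂ] Mat (Fin d))}
    (hT : ∀ i, IsChannel (T i))
    (htel : ∀ ρ : Mat (Fin d),
      ∑ i, T i (ptraceFst ((F i ⊗ₖ (1 : Mat (Fin d))) * tensorState ρ W)) = ρ) :
    ∃ (ω : Mat (Fin d)) (ψ V : Fin (d ^ 2) → Mat (Fin d)) (f : Fin (d ^ 2) → ℂ),
      W = pureState ω ∧ (∀ i, F i = outer (flat (ψ i))) ∧
      (∀ i, V i ∈ Matrix.unitaryGroup (Fin d) ℂ) ∧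
      (∀ i σ, T i σ = (V i)ᴴ * σ * V i) ∧ ∀ i, ω * (ψ i)ᴴ = f i • V i := by
  have : Nonempty (Fin d) := ⟨⟨0, hd⟩⟩
  have : Nonempty (Fin (d ^ 2)) := ⟨⟨0, by positivity⟩⟩
  obtain ⟨ω, hω⟩ : ∃ ω : Fin d × Fin d → Mat (Fin d), W = ∑ a, pureState (ω a) := by
    obtain ⟨v, hv⟩ := exists_sum_outer hW
    exact ⟨fun a => of fun s h => v a (h, s), hv⟩
  have hF : ∀ i, ∃ φ : Fin d × Fin d → Mat (Fin d), F i = ∑ b, outer (flat (φ b)) := fun i => by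
    obtain ⟨v, hv⟩ := exists_sum_outer (hFpos i)
    exact ⟨fun b => of fun a h => v b (a, h), hv⟩
  choose φ hφ using hF
  choose K hK using fun i => (hT i).1.exists_kraus
  have hKK : ∀ i, ∑ γ, (K i γ)ᴴ * K i γ = 1 := fun i =>
    sum_conjTranspose_mul_eq_one fun X => by rw [← hK, (hT i).2]
  let A : Fin (d ^ 2) × (Fin d × Fin d) × (Fin d × Fin d) × (Fin d × Fin d) → Mat (Fin d) :=
    fun j => K j.1 j.2.1 * (ω j.2.2.1 * (φ j.1 j.2.2.2)ᴴ)
  have hA : ∀ ρ, ∑ j, A j * ρ * (A j)ᴴ = ρ := fun ρ => by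
    conv_rhs => rw [← htel ρ]
    rw [Fintype.sum_prod_type]
    refine Finset.sum_congr rfl fun i _ => ?_
    rw [hω, hφ, ptraceFst_sum, hK, Fintype.sum_prod_type]
    refine Finset.sum_congr rfl fun γ _ => ?_
    rw [Fintype.sum_prod_type, Finset.mul_sum, Finset.sum_mul]
    refine Finset.sum_congr rfl fun α _ => ?_
    rw [Finset.mul_sum, Finset.sum_mul]
    refine Finset.sum_congr rfl fun β _ => ?_
    simp only [A, conjTranspose_mul, Matrix.mul_assoc]
  have hs : ∀ i α β γ, ∃ c : ℂ, K i γ * (ω α * (φ i β)ᴴ) = c • (1 : Mat (Fin d)) :=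
    fun i α β γ => kraus_identity_scalar hA (i, γ, α, β)
  obtain ⟨α₀, Ω, hΩ⟩ : ∃ α₀ Ω, Ω * ω α₀ = 1 := by
    obtain ⟨j, hj⟩ : ∃ j, A j ≠ 0 := by
      by_contra! h0
      have := hA 1
      simp [h0] at this
    obtain ⟨c, hc⟩ := kraus_identity_scalar hA j
    have hc0 : c ≠ 0 := by
      rintro rfl
      exact hj (by rw [hc, zero_smul])
    refine ⟨j.2.2.1, c⁻¹ • ((φ j.1 j.2.2.2)ᴴ * K j.1 j.2.1), mul_eq_one_comm.1 ?_⟩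
    have h1 : K j.1 j.2.1 * (c⁻¹ • (ω j.2.2.1 * (φ j.1 j.2.2.2)ᴴ)) = 1 := by
      rw [Matrix.mul_smul]
      change c⁻¹ • A j = 1
      rw [hc, smul_smul, inv_mul_cancel₀ hc0, one_smul]
    rw [← mul_eq_one_comm.1 h1]
    simp only [Matrix.mul_smul, Matrix.smul_mul, Matrix.mul_assoc]
  have hbranch : ∀ i, F i ≠ 0 → ∃ V ∈ Matrix.unitaryGroup (Fin d) ℂ,
      (∀ σ, T i σ = Vᴴ * σ * V) ∧ (∀ α, ∃ b : ℂ, ω α = b • ω α₀) ∧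
      ∃ (ψ : Mat (Fin d)) (f : ℂ), F i = outer (flat ψ) ∧ ω α₀ * ψᴴ = f • V := fun i hi => by
    obtain ⟨β₁, hβ₁⟩ : ∃ β, φ i β ≠ 0 := by
      by_contra! h0
      exact hi (by simp [hφ, h0, flat_zero, outer_zero])
    simpa only [hK, hφ i] using unitary_of_scalar_products (hKK i) (hs i) hΩ hβ₁
  have hrank : ∀ i, ∃ ψ : Mat (Fin d), F i = outer (flat ψ) := fun i => by
    by_cases hi : F i = 0
    · exact ⟨0, by rw [hi, flat_zero, outer_zero]⟩
    · obtain ⟨-, -, -, -, ψ, -, hψ, -⟩ := hbranch i hi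
      exact ⟨ψ, hψ⟩
  have hne : ∀ i, F i ≠ 0 := by
    choose ψ hψ using hrank
    intro i hi
    have h1 := trace_conjTranspose_mul_of_sum_outer
      (hFsum ▸ Finset.sum_congr rfl fun i _ => (hψ i).symm) i i
    have h2 : (F i).trace = ((ψ i)ᴴ * ψ i).trace := by
      rw [hψ i]
      simp only [outer, flat, Matrix.trace, Matrix.diag_apply, vecMulVec_apply,
        Matrix.mul_apply, Fintype.sum_prod_type, conjTranspose_apply, Pi.star_apply]
      rw [Finset.sum_comm]
      simp only [mul_comm]
    rw [← h2, hi] at h1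
    simp at h1
  choose V hV hTV hprop ψ f hψ hf using fun i => hbranch i (hne i)
  choose b hb using hprop (Classical.arbitrary _)
  obtain ⟨r, hr⟩ := exists_sum_outer_smul b (pureVec (ω α₀))
  refine ⟨r • ω α₀, ψ, V, fun i => r * f i, ?_, hψ, hV, hTV, fun i => ?_⟩
  · rw [hω]
    refine Eq.trans (Finset.sum_congr rfl fun a _ => ?_) hr
    rw [hb a]
    rfl
  · rw [Matrix.smul_mul, hf, smul_smul]

/-- **Werner's classification of tight teleportation schemes (necessity).**
If `W` is a state on `M_d(ℂ) ⊗ M_d(ℂ)`, `(F i)` is a `d²`-outcome POVM on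
`ℂ^d ⊗ ℂ^d`, and `(T i)` are channels on `M_d(ℂ)` satisfying the teleportation
equation, then `W` is a maximally entangled pure state, the `F i` are the rank-one
projections onto `(Uᵢ ⊗ I)w` for a unitary error basis `(Uᵢ)`, and the corrections
`T i` are unitary channels. -/
theorem tight_teleportation_classification
    (d : ℕ) (hd : 1 ≤ d)
    (W : Mat (Fin d × Fin d)) (hW : IsState W)
    (F : Fin (d ^ 2) → Mat (Fin d × Fin d))
    (hFpos : ∀ i, (F i).PosSemidef) (hFsum : ∑ i, F i = 1)
    (T : Fin (d ^ 2) → (Mat (Fin d) →ₗ[ℂ] Mat (Fin d)))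
    (hT : ∀ i, IsChannel (T i))
    (htel : ∀ ρ : Mat (Fin d),
      ∑ i, T i (ptraceFst ((F i ⊗ₖ (1 : Mat (Fin d))) * tensorState ρ W)) = ρ) :
    ∃ w : Fin d × Fin d → ℂ,
      star w ⬝ᵥ w = 1 ∧
      ptraceSnd (outer w) = ((d : ℂ))⁻¹ • (1 : Mat (Fin d)) ∧
      W = outer w ∧
      ∃ U : Fin (d ^ 2) → Mat (Fin d),
        (∀ i, U i ∈ Matrix.unitaryGroup (Fin d) ℂ) ∧
        (∀ i j, ((d : ℂ))⁻¹ * ((U i)ᴴ * U j).trace = if i = j then 1 else 0) ∧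
        (∀ i, F i = outer ((U i ⊗ₖ (1 : Mat (Fin d))) *ᵥ w)) ∧
        ∃ Vu : Fin (d ^ 2) → Mat (Fin d),
          (∀ i, Vu i ∈ Matrix.unitaryGroup (Fin d) ℂ) ∧
          (∀ i (ρ : Mat (Fin d)),
            ptraceFst ((F i ⊗ₖ (1 : Mat (Fin d))) * tensorState ρ W)
              = (((d : ℂ) ^ 2)⁻¹) • (Vu i * ρ * (Vu i)ᴴ)) ∧
          (∀ i (σ : Mat (Fin d)), T i σ = (Vu i)ᴴ * σ * Vu i) := by
  have hd0 : (d : ℂ) ≠ 0 := by exact_mod_cast (by omega : d ≠ 0)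
  obtain ⟨ω, ψ, V, f, rfl, hFψ, hV, hT', hf⟩ := exists_pure_form hd hW.1 hFpos hFsum hT htel
  obtain rfl : F = fun i => outer (flat (ψ i)) := funext hFψ
  have hω : (ω * ωᴴ).trace = 1 := by rw [← trace_pureState, hW.2]
  have hVV : ∀ i, V i * (V i)ᴴ = 1 := fun i => mem_unitaryGroup_iff.1 (hV i)
  obtain ⟨hωω, hff, hψψ⟩ := maximally_entangled_of_mul_eq_smul hd hω hFsum hVV hf
  have hmap : ω.map star * ωᵀ = (d : ℂ)⁻¹ • (1 : Mat (Fin d)) := by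
    have h := congrArg transpose hωω
    rwa [transpose_mul, transpose_smul, transpose_one, conjTranspose,
      ← transpose_map, transpose_transpose] at h
  have hmap' : ωᵀ * ω.map star = (d : ℂ)⁻¹ • (1 : Mat (Fin d)) := by
    have h1 : ω.map star * ((d : ℂ) • ωᵀ) = 1 := by
      rw [Matrix.mul_smul, hmap, smul_smul, mul_inv_cancel₀ hd0, one_smul]
    have h2 := mul_eq_one_comm.1 h1
    rw [← h2, Matrix.smul_mul, smul_smul, inv_mul_cancel₀ hd0, one_smul]
  have hconj : (ω.map star)ᴴ = ωᵀ := by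
    ext x y
    simp
  have hU : ∀ i j, ((d : ℂ) • (ψ i * ω.map star))ᴴ * ((d : ℂ) • (ψ j * ω.map star))
      = ((d : ℂ) ^ 2) • (ωᵀ * ((ψ i)ᴴ * ψ j) * ω.map star) := fun i j => by
    rw [conjTranspose_smul, conjTranspose_mul, hconj, Matrix.smul_mul, Matrix.mul_smul, smul_smul]
    simp only [Matrix.mul_assoc, Complex.star_def, Complex.conj_natCast, sq]
  refine ⟨pureVec ω, ?_, ?_, rfl, fun i => (d : ℂ) • (ψ i * ω.map star), fun i => ?_,
    fun i j => ?_, fun i => ?_, V, hV, fun i ρ => ?_, hT'⟩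
  · rw [← trace_outer]
    exact hW.2
  · rw [← hmap']
    ext x y
    simp [ptraceSnd, outer, pureVec, vecMulVec_apply, Matrix.mul_apply]
  · rw [mem_unitaryGroup_iff', star_eq_conjTranspose, hU, hψψ, Matrix.mul_smul, Matrix.mul_one,
      Matrix.smul_mul, hmap', smul_smul, smul_smul]
    rw [show (d : ℂ) ^ 2 * (d : ℂ)⁻¹ * (d : ℂ)⁻¹ = 1 by field_simp, one_smul]
  · rw [hU, trace_smul, trace_mul_comm, ← Matrix.mul_assoc, hmap, Matrix.smul_mul, Matrix.one_mul,
      trace_smul, trace_conjTranspose_mul_of_sum_outer hFsum]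
    split_ifs
    · simp only [smul_eq_mul]
      field_simp
    · simp
  · rw [kronecker_one_mulVec_pureVec, Matrix.smul_mul, Matrix.mul_assoc, hmap, Matrix.mul_smul,
      Matrix.mul_one, smul_smul, mul_inv_cancel₀ hd0, one_smul]
  · rw [ptraceFst_pure, hf, conjTranspose_smul, Matrix.smul_mul, Matrix.mul_smul, Matrix.smul_mul,
      smul_smul, mul_comm (star _), hff]

end EntInvPaper
end
end
end

section
/- Biunitarity characterisation of channels entanglement-invertible with respect to the canonical maximally entangled state (matrix-algebra case). Let a, b, h ≥ 1 and let M : M_a(ℂ)⊗M_h(ℂ) → M_b(ℂ) be a channel. Then M is entanglement-invertible with respect to the canonical maximally entangled state |Ω_h⟩⟨Ω_h| of M_h(ℂ)⊗M_h(ℂ) if and only if there exists a unitary V : ℂ^a⊗ℂ^h → ℂ^b⊗ℂ^h such that M(z) = Tr_{ℂ^h}(V z V†) for all z ∈ M_a(ℂ)⊗M_h(ℂ) (partial trace over the second tensor factor) and the rearrangement Ṽ : ℂ^a⊗ℂ^h → ℂ^h⊗ℂ^b, defined on standard-basis matrix entries by Ṽ_{(k,j),(i,f)} := V_{(j,f),(i,k)},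 is also unitary (i.e. V is a biunitary). In particular, entanglement-invertibility forces a = b. -/
noncomputable section

open Matrix Kronecker
open scoped ComplexOrder

noncomputable section
open Matrix Kronecker
open scoped ComplexOrder
namespace EntInvPaper

/-- The Choi matrix `∑ E_{xy} ⊗ Φ(E_{xy})`. -/
def choi {n m : Type} [DecidableEq n] (Φ : Mat n →ₗ[ℂ] Mat m) : Mat (n × m) :=
  Matrix.of fun p q => Φ (Matrix.single p.1 q.1 1) p.2 q.2

lemma IsCP.posSemidef_choi {n m : Type} [Fintype n] [DecidableEq n] [Fintype m]
    {Φ : Mat n →ₗ[ℂ] Mat m} (hΦ : IsCP Φ) : (choi Φ).PosSemidef := by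
  classical
  let σ := Fintype.equivFin n
  let v : Fin (Fintype.card n) × n → ℂ := fun p => if σ p.2 = p.1 then 1 else 0
  have key := (hΦ _ _ (Matrix.posSemidef_vecMulVec_self_star v)).submatrix
    (fun p : n × m => (σ p.1, p.2))
  convert key using 1
  ext p q
  simp only [choi, amplL, of_apply, submatrix_apply]
  refine congrArg (fun z => Φ z p.2 q.2) ?_
  ext x y
  have hv : ∀ w x, v (σ w, x) = if w = x then 1 else 0 := fun w x => by simp [v, eq_comm]
  by_cases hx : p.1 = x <;> by_cases hy : q.1 = y <;>
    simp [vecMulVec_apply, hv, hx, hy]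

lemma apply_eq_sum_choi {n m : Type} [Fintype n] [DecidableEq n]
    (Φ : Mat n →ₗ[ℂ] Mat m) (z : Mat n) (j j' : m) :
    Φ z j j' = ∑ x, ∑ y, z x y * choi Φ (x, j) (y, j') := by
  conv_lhs => rw [matrix_eq_sum_single z]
  simp only [map_sum, Matrix.sum_apply]
  refine Finset.sum_congr rfl fun x _ => Finset.sum_congr rfl fun y _ => ?_
  have : (Matrix.single x y (z x y) : Mat n) = z x y • Matrix.single x y 1 := by simp
  rw [this, map_smul]
  rfl

lemma conjBy_apply_apply {p q : Type} [Fintype q] (C : Matrix p q ℂ) (X : Mat q) (j j' : p) :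
    conjBy C X j j' = ∑ x, ∑ y, C j x * X x y * star (C j' y) := by
  show (C * X * Cᴴ) j j' = _
  simp only [Matrix.mul_apply, conjTranspose_apply, Finset.sum_mul]
  exact Finset.sum_comm

/-- A completely positive map has a Kraus family of nonzero, pairwise Hilbert–Schmidt
orthogonal operators. -/
lemma IsCP.exists_orthogonal_kraus {n m : Type} [Fintype n] [Fintype m]
    {Φ : Mat n →ₗ[ℂ] Mat m} (hΦ : IsCP Φ) :
    ∃ (e : ℕ) (K : Fin e → Matrix m n ℂ) (μ : Fin e → ℂ), Φ = ∑ f, conjBy (K f) ∧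
      (∀ f, μ f ≠ 0) ∧ ∀ f f', ((K f)ᴴ * K f').trace = if f = f' then μ f else 0 := by
  classical
  have hC := hΦ.posSemidef_choi
  let ev := hC.1.eigenvalues
  let U : Matrix (n × m) (n × m) ℂ := hC.1.eigenvectorUnitary
  have hU : Uᴴ * U = 1 := (mem_unitaryGroup_iff').1 hC.1.eigenvectorUnitary.2
  have hspec : choi Φ = U * diagonal (fun f => (ev f : ℂ)) * Uᴴ := by
    have := hC.1.spectral_theorem
    rw [Unitary.conjStarAlgAut_apply] at this
    exact this
  have hsq : ∀ f, ((Real.sqrt (ev f) : ℝ) : ℂ) * (Real.sqrt (ev f) : ℝ) = ev f := fun f => by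
    rw [← Complex.ofReal_mul, Real.mul_self_sqrt (hC.eigenvalues_nonneg f)]
  let σ := (Fintype.equivFin {f // ev f ≠ 0}).symm
  let K₀ : n × m → Matrix m n ℂ := fun f => of fun j x => (Real.sqrt (ev f) : ℝ) * U (x, j) f
  have hsum : Φ = ∑ f, conjBy (K₀ f) := by
    refine LinearMap.ext fun z => ?_
    ext j j'
    rw [apply_eq_sum_choi, LinearMap.sum_apply, Matrix.sum_apply]
    simp only [conjBy_apply_apply]
    rw [Finset.sum_comm]
    conv_rhs => rw [Finset.sum_comm]; enter [2, x]; rw [Finset.sum_comm]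
    rw [Finset.sum_comm]
    refine Finset.sum_congr rfl fun x _ => Finset.sum_congr rfl fun y _ => ?_
    rw [hspec, Matrix.mul_apply, Finset.mul_sum]
    refine Finset.sum_congr rfl fun f _ => ?_
    simp only [mul_diagonal, conjTranspose_apply, K₀, of_apply, star_mul', ← hsq]
    simp only [RCLike.star_def, Complex.conj_ofReal]
    ring
  refine ⟨_, fun f => K₀ (σ f), fun f => ev (σ f), ?_, fun f => ?_, fun f f' => ?_⟩
  · rw [hsum, Equiv.sum_comp σ (fun f => conjBy (K₀ f))]
    have hzero : ∀ f, ¬ ev f ≠ 0 → conjBy (K₀ f) = 0 := fun f hf => by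
      have : K₀ f = 0 := by
        ext j x
        simp [K₀, not_not.1 hf]
      refine LinearMap.ext fun z => ?_
      simp [this, conjBy]
    rw [← Fintype.sum_subtype_add_sum_subtype (fun f => ev f ≠ 0) (fun f => conjBy (K₀ f)),
      Finset.sum_eq_zero (s := (Finset.univ : Finset {f // ¬ ev f ≠ 0}))
        (fun f _ => hzero f f.2), add_zero]
  · exact Complex.ofReal_ne_zero.2 (σ f).2
  · have h1 := congrFun (congrFun hU (σ f).1) (σ f').1
    simp only [Matrix.mul_apply, conjTranspose_apply, Fintype.sum_prod_type] at h1
    have h2 : ((K₀ (σ f))ᴴ * K₀ (σ f')).trace =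
        (Real.sqrt (ev (σ f)) : ℝ) * (Real.sqrt (ev (σ f')) : ℝ) *
          (1 : Mat (n × m)) (σ f).1 (σ f').1 := by
      rw [← h1]
      simp only [trace, diag_apply, Matrix.mul_apply, conjTranspose_apply, K₀, of_apply,
        star_mul', Finset.mul_sum, RCLike.star_def, Complex.conj_ofReal]
      exact Finset.sum_congr rfl fun x _ => Finset.sum_congr rfl fun y _ => by ring
    rw [h2, one_apply]
    by_cases hf : f = f'
    · subst hf
      simp [hsq]
    · have : (σ f).1 ≠ (σ f').1 := fun h => hf (σ.injective (Subtype.ext h))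
      simp [hf, this]

/-- Trace preservation of a Kraus sum is the completeness relation. -/
lemma sum_conjTranspose_mul_self_eq_one {n m ι : Type} [Fintype n] [DecidableEq n] [Fintype m]
    [Fintype ι] {K : ι → Matrix m n ℂ}
    (hK : ∀ X : Mat n, ((∑ f, conjBy (K f)) X).trace = X.trace) :
    ∑ f, (K f)ᴴ * K f = 1 := by
  refine Matrix.ext_iff_trace_mul_right.2 fun X => ?_
  rw [Matrix.one_mul, ← hK X, LinearMap.sum_apply, trace_sum, Finset.sum_mul, trace_sum]
  refine Finset.sum_congr rfl fun f _ => ?_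
  show _ = (K f * X * (K f)ᴴ).trace
  rw [trace_mul_comm (K f * X), ← Matrix.mul_assoc]

lemma isChannel_sum_conjBy {n m ι : Type} [Fintype n] [DecidableEq n] [Fintype m]
    [Fintype ι] {K : ι → Matrix m n ℂ} (hK : ∑ f, (K f)ᴴ * K f = 1) :
    IsChannel (∑ f, conjBy (K f)) := by
  classical
  refine ⟨fun k X hX => ?_, fun X => ?_⟩
  · have : amplL (Fin k) (∑ f, conjBy (K f)) X =
        ∑ f, ((1 : Mat (Fin k)) ⊗ₖ K f) * X * ((1 : Mat (Fin k)) ⊗ₖ K f)ᴴ := by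
      ext p q
      simp only [amplL, of_apply, LinearMap.sum_apply, Matrix.sum_apply, conjBy_apply_apply]
      refine Finset.sum_congr rfl fun f _ => ?_
      have := conjBy_apply_apply ((1 : Mat (Fin k)) ⊗ₖ K f) X p q
      refine Eq.trans ?_ this.symm
      simp [Fintype.sum_prod_type, kroneckerMap_apply, one_apply, apply_ite (starRingEnd ℂ)]
    rw [this]
    exact posSemidef_sum _ fun f _ => hX.mul_mul_conjTranspose_same _
  · rw [LinearMap.sum_apply, trace_sum]
    calc ∑ f, (K f * X * (K f)ᴴ).trace = ((∑ f, (K f)ᴴ * K f) * X).trace := by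
          rw [Finset.sum_mul, trace_sum]
          exact Finset.sum_congr rfl fun f _ => by rw [trace_mul_comm, ← Matrix.mul_assoc]
      _ = X.trace := by rw [hK, Matrix.one_mul]

lemma inv_sqrt_mul_self (h : ℕ) :
    ((Real.sqrt h : ℝ) : ℂ)⁻¹ * ((Real.sqrt h : ℝ) : ℂ)⁻¹ = (h : ℂ)⁻¹ := by
  rw [← mul_inv, ← Complex.ofReal_mul, Real.mul_self_sqrt (by positivity), Complex.ofReal_natCast]

/-- The Kraus operator of `x ↦ (M ⊗ id)(x ⊗ |Ω⟩⟨Ω|)` coming from a Kraus operator of `M`. -/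
def encodeKraus {a b h : ℕ} (K : Matrix (Fin b) (Fin a × Fin h) ℂ) :
    Matrix (Fin b × Fin h) (Fin a) ℂ :=
  of fun p i => ((Real.sqrt h : ℝ) : ℂ)⁻¹ * K p.1 (i, p.2)

lemma amplR_tensorState_canME {a b h : ℕ} {ι : Type} [Fintype ι]
    (K : ι → Matrix (Fin b) (Fin a × Fin h) ℂ) (x : Mat (Fin a)) :
    amplR (Fin h) (∑ f, conjBy (K f)) (tensorState x (canME h)) =
      (∑ f, conjBy (encodeKraus (K f))) x := by
  ext p q
  simp only [amplR, of_apply, LinearMap.sum_apply, Matrix.sum_apply, conjBy_apply_apply]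
  refine Finset.sum_congr rfl fun f _ => ?_
  simp [Fintype.sum_prod_type, tensorState, canME, outer, omegaVec, vecMulVec_apply,
    encodeKraus, kroneckerMap_apply, apply_ite (starRingEnd ℂ)]
  exact Finset.sum_congr rfl fun i _ => Finset.sum_congr rfl fun i' _ => by ring

lemma swapState_canME (h : ℕ) : swapState (canME h) = canME h := by
  ext p q
  simp [swapState, canME, outer, omegaVec, vecMulVec_apply, eq_comm]

lemma conjBy_conjBy {p q r : Type} [Fintype q] [Fintype r] (C : Matrix p q ℂ) (D : Matrix q r ℂ)
    (X : Mat r) : conjBy C (conjBy D X) = conjBy (C * D) X := by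
  simp [conjBy, Matrix.mul_assoc, conjTranspose_mul]

lemma apply_amplR_tensorState_canME {a b h : ℕ} {ι κ : Type} [Fintype ι] [Fintype κ]
    (K : ι → Matrix (Fin b) (Fin a × Fin h) ℂ) (L : κ → Matrix (Fin a) (Fin b × Fin h) ℂ)
    (x : Mat (Fin a)) :
    (∑ g, conjBy (L g)) (amplR (Fin h) (∑ f, conjBy (K f)) (tensorState x (canME h))) =
      (∑ p : κ × ι, conjBy (L p.1 * encodeKraus (K p.2))) x := by
  rw [amplR_tensorState_canME]
  simp only [LinearMap.sum_apply, map_sum, conjBy_conjBy, Fintype.sum_prod_type]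
  exact Finset.sum_comm

/-- Kraus operators of the identity channel are scalar. -/
lemma eq_smul_one_of_sum_conjBy_eq_id {n ι : Type} [Fintype n] [DecidableEq n] [Fintype ι]
    {T : ι → Mat n} (hT : ∀ x, (∑ f, conjBy (T f)) x = x) (f : ι) :
    ∃ c : ℂ, T f = c • 1 := by
  have entry : ∀ p q i j : n, ∑ f, T f p i * star (T f q j) =
      Matrix.single i j (1 : ℂ) p q := fun p q i j => by
    have := congrFun (congrFun (hT (Matrix.single i j 1)) p) q
    rw [← this, LinearMap.sum_apply, Matrix.sum_apply]
    refine Finset.sum_congr rfl fun f _ => ?_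
    rw [conjBy_apply_apply, Finset.sum_eq_single i, Finset.sum_eq_single j] <;>
      simp +contextual [single_apply, eq_comm]
  have vanish : ∀ t : ι → ℂ, ∑ f, t f * star (t f) = 0 → ∀ f, t f = 0 := fun t ht f => by
    have : t ⬝ᵥ star t = 0 := ht
    exact congrFun (dotProduct_self_star_eq_zero.1 this) f
  have off : ∀ p i, p ≠ i → ∀ f, T f p i = 0 := fun p i hpi =>
    vanish _ (by rw [entry]; simp [hpi.symm])
  have diag : ∀ i j, ∀ f, T f i i - T f j j = 0 := fun i j =>
    vanish _ (by
      simp only [star_sub, mul_sub, sub_mul, Finset.sum_sub_distrib, entry]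
      simp)
  rcases isEmpty_or_nonempty n with hn | ⟨⟨i⟩⟩
  · exact ⟨0, Subsingleton.elim _ _⟩
  · refine ⟨T f i i, ?_⟩
    ext p q
    by_cases hpq : p = q
    · subst hpq
      simpa using sub_eq_zero.1 (diag p i f)
    · simp [hpq, off p q hpq f]

/-- The operator `ℂ^n → ℂ^m ⊗ ℂ^e` assembled from a Kraus family. -/
def stack {n m ι : Type} (K : ι → Matrix m n ℂ) : Matrix (m × ι) n ℂ := of fun p x => K p.2 p.1 x

/-- The slices `V_f = (I ⊗ ⟨f|)V` of an operator into `ℂ^m ⊗ ℂ^e`. -/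
def slice {n m ι : Type} (V : Matrix (m × ι) n ℂ) (f : ι) : Matrix m n ℂ := of fun j x => V (j, f) x

lemma ptraceSnd_conj {n m ι : Type} [Fintype n] [Fintype ι] (V : Matrix (m × ι) n ℂ) (z : Mat n) :
    ptraceSnd (V * z * Vᴴ) = (∑ f, conjBy (slice V f)) z := by
  ext j j'
  rw [LinearMap.sum_apply, Matrix.sum_apply]
  rfl

lemma stack_conjTranspose_mul_self {n m ι : Type} [Fintype m] [Fintype ι]
    (K : ι → Matrix m n ℂ) : (stack K)ᴴ * stack K = ∑ f, (K f)ᴴ * K f := by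
  ext x y
  simp only [Matrix.mul_apply, Matrix.sum_apply, Fintype.sum_prod_type, stack,
    conjTranspose_apply, of_apply]
  exact Finset.sum_comm

lemma rearrange_gram {a b h e : ℕ} (V : Matrix (Fin b × Fin e) (Fin a × Fin h) ℂ)
    (p q : Fin a × Fin e) : ((rearrange V)ᴴ * rearrange V) p q =
      ∑ k, ∑ j, star (V (j, p.2) (p.1, k)) * V (j, q.2) (q.1, k) := by
  simp [Matrix.mul_apply, rearrange, Fintype.sum_prod_type]

/-- A channel that is reversible with respect to the canonical maximally entangled state has a
dilation whose rearrangement has orthogonal nonzero columns. -/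
lemma EntReversible.exists_dilation {a b h : ℕ} (ha : 1 ≤ a) (hh : 1 ≤ h)
    {M : Mat (Fin a × Fin h) →ₗ[ℂ] Mat (Fin b)} (hM : IsChannel M)
    (hrev : EntReversible M (canME h)) :
    ∃ (e : ℕ) (V : Matrix (Fin b × Fin e) (Fin a × Fin h) ℂ) (μ : Fin e → ℂ),
      IsDilation M V ∧ (∀ f, μ f ≠ 0) ∧
      (rearrange V)ᴴ * rearrange V = 1 ⊗ₖ diagonal μ := by
  obtain ⟨N, hN, hinv⟩ := hrev
  obtain ⟨e, K, μ, hK, hμ, hKo⟩ := hM.1.exists_orthogonal_kraus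
  obtain ⟨e', L, -, hL, -, -⟩ := hN.1.exists_orthogonal_kraus
  have hK1 := sum_conjTranspose_mul_self_eq_one (fun X => hK ▸ hM.2 X)
  have hL1 := sum_conjTranspose_mul_self_eq_one (fun X => hL ▸ hN.2 X)
  have hid : ∀ x, (∑ p : Fin e' × Fin e, conjBy (L p.1 * encodeKraus (K p.2))) x = x :=
    fun x => by rw [← apply_amplR_tensorState_canME, ← hK, ← hL, hinv x]
  choose t ht using eq_smul_one_of_sum_conjBy_eq_id hid
  have hKL : ∀ f f', ∃ c : ℂ, (encodeKraus (K f))ᴴ * encodeKraus (K f') = c • 1 := fun f f' => by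
    refine ⟨∑ g, star (t (g, f)) * t (g, f'), ?_⟩
    calc (encodeKraus (K f))ᴴ * encodeKraus (K f')
        = (encodeKraus (K f))ᴴ * (∑ g, (L g)ᴴ * L g) * encodeKraus (K f') := by
          rw [hL1, Matrix.mul_one]
      _ = ∑ g, (L g * encodeKraus (K f))ᴴ * (L g * encodeKraus (K f')) := by
          simp only [Matrix.mul_sum, Matrix.sum_mul, conjTranspose_mul, Matrix.mul_assoc]
      _ = _ := by
          rw [Finset.sum_smul]
          refine Finset.sum_congr rfl fun g _ => ?_
          rw [ht (g, f), ht (g, f')]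
          simp [smul_smul, mul_comm]
  choose c hc using hKL
  have hh0 : (h : ℂ) ≠ 0 := by exact_mod_cast (by omega : h ≠ 0)
  have ha0 : (a : ℂ) ≠ 0 := by exact_mod_cast (by omega : a ≠ 0)
  have hgram : ∀ p q, ((rearrange (stack K))ᴴ * rearrange (stack K)) p q =
      h * c p.2 q.2 * (1 : Mat (Fin a)) p.1 q.1 := fun p q => by
    have h1 := congrFun (congrFun (hc p.2 q.2) p.1) q.1
    rw [Matrix.smul_apply, smul_eq_mul] at h1
    rw [rearrange_gram, mul_assoc, ← h1, Matrix.mul_apply, Fintype.sum_prod_type,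
      Finset.sum_comm, Finset.mul_sum]
    refine Finset.sum_congr rfl fun j _ => ?_
    rw [Finset.mul_sum]
    refine Finset.sum_congr rfl fun k _ => ?_
    simp only [stack, encodeKraus, conjTranspose_apply, of_apply, star_mul', star_inv₀,
      RCLike.star_def, Complex.conj_ofReal]
    rw [mul_mul_mul_comm, inv_sqrt_mul_self, mul_inv_cancel_left₀ hh0]
  have htr : ∀ f f', (a : ℂ) * (h * c f f') = if f = f' then μ f else 0 := fun f f' => by
    rw [← hKo]
    have h1 : ∑ i, ((rearrange (stack K))ᴴ * rearrange (stack K)) (i, f) (i, f') =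
        a * (h * c f f') := by
      simp [hgram]
    rw [← h1]
    simp only [rearrange_gram]
    simp only [trace, diag_apply, Matrix.mul_apply, conjTranspose_apply, stack, of_apply,
      Fintype.sum_prod_type]
  refine ⟨e, stack K, fun f => (a : ℂ)⁻¹ * μ f, ⟨?_, fun z => ?_⟩, fun f => ?_, ?_⟩
  · rw [stack_conjTranspose_mul_self, hK1]
  · rw [ptraceSnd_conj]
    exact congrArg (· z) hK
  · exact mul_ne_zero (inv_ne_zero ha0) (hμ f)
  · ext p q
    rw [hgram, kroneckerMap_apply, diagonal_apply, mul_comm]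
    congr 1
    rw [← mul_right_inj' ha0, htr]
    split_ifs <;> simp [ha0]

lemma card_le_of_mul_eq_one {m n : Type} [Fintype m] [Fintype n] [DecidableEq n]
    {A : Matrix m n ℂ} {B : Matrix n m ℂ} (hBA : B * A = 1) :
    Fintype.card n ≤ Fintype.card m := by
  have := rank_mul_le_right B A
  rw [hBA, rank_one] at this
  exact this.trans (rank_le_card_height A)

lemma dilation_dimension_bounds {a b h e : ℕ} {V : Matrix (Fin b × Fin e) (Fin a × Fin h) ℂ}
    {μ : Fin e → ℂ} (hV : Vᴴ * V = 1) (hμ : ∀ f, μ f ≠ 0)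
    (hR : (rearrange V)ᴴ * rearrange V = 1 ⊗ₖ diagonal μ) :
    a * h ≤ b * e ∧ a * e ≤ h * b := by
  have h1 := card_le_of_mul_eq_one hV
  have h2 : ((1 : Mat (Fin a)) ⊗ₖ diagonal (fun f => (μ f)⁻¹) * (rearrange V)ᴴ) * rearrange V = 1 := by
    rw [Matrix.mul_assoc, hR, ← mul_kronecker_mul, diagonal_mul_diagonal]
    simp [hμ]
  have h3 := card_le_of_mul_eq_one h2
  simpa using And.intro h1 h3

lemma EntInvertible.symm {a b h : ℕ} {M : Mat (Fin a × Fin h) →ₗ[ℂ] Mat (Fin b)}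
    (hM : IsChannel M) (hinv : EntInvertible M (canME h)) :
    ∃ N : Mat (Fin b × Fin h) →ₗ[ℂ] Mat (Fin a), IsChannel N ∧ EntInvertible N (canME h) := by
  obtain ⟨N, hN, hl, hr⟩ := hinv
  exact ⟨N, hN, M, hM, swapState_canME h ▸ hr,
    fun x => by rw [swapState_canME]; exact hl x⟩

lemma EntInvertible.reversible {a b h : ℕ} {M : Mat (Fin a × Fin h) →ₗ[ℂ] Mat (Fin b)}
    (hinv : EntInvertible M (canME h)) : EntReversible M (canME h) :=
  let ⟨N, hN, hl, _⟩ := hinv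
  ⟨N, hN, hl⟩

lemma EntReversible.dim_le {a b h : ℕ} (ha : 1 ≤ a) (hh : 1 ≤ h)
    {M : Mat (Fin a × Fin h) →ₗ[ℂ] Mat (Fin b)} (hM : IsChannel M)
    (hrev : EntReversible M (canME h)) : a ≤ b := by
  obtain ⟨e, V, μ, ⟨hV, -⟩, hμ, hR⟩ := hrev.exists_dilation ha hh hM
  obtain ⟨h1, h2⟩ := dilation_dimension_bounds hV hμ hR
  by_contra! hlt
  have h3 : a * (a * h) ≤ b * (h * b) := by
    calc a * (a * h) ≤ a * (b * e) := Nat.mul_le_mul_left _ h1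
      _ = b * (a * e) := by ring
      _ ≤ b * (h * b) := Nat.mul_le_mul_left _ h2
  have h4 : b * b < a * a := Nat.mul_self_lt_mul_self hlt
  nlinarith

lemma EntInvertible.dim_eq {a b h : ℕ} (ha : 1 ≤ a) (hb : 1 ≤ b) (hh : 1 ≤ h)
    {M : Mat (Fin a × Fin h) →ₗ[ℂ] Mat (Fin b)} (hM : IsChannel M)
    (hinv : EntInvertible M (canME h)) : a = b := by
  obtain ⟨N, hN, hinv'⟩ := hinv.symm hM
  exact le_antisymm (hinv.reversible.dim_le ha hh hM) (hinv'.reversible.dim_le hb hh hN)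

lemma EntInvertible.exists_biunitary {a b h : ℕ} (ha : 1 ≤ a) (hb : 1 ≤ b) (hh : 1 ≤ h)
    {M : Mat (Fin a × Fin h) →ₗ[ℂ] Mat (Fin b)} (hM : IsChannel M)
    (hinv : EntInvertible M (canME h)) :
    ∃ V : Matrix (Fin b × Fin h) (Fin a × Fin h) ℂ,
      Vᴴ * V = 1 ∧ V * Vᴴ = 1 ∧
      (∀ z : Mat (Fin a × Fin h), M z = ptraceSnd (V * z * Vᴴ)) ∧
      (rearrange V)ᴴ * rearrange V = 1 ∧ rearrange V * (rearrange V)ᴴ = 1 := by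
  obtain rfl := hinv.dim_eq ha hb hh hM
  obtain ⟨e, V, μ, ⟨hV, hdil⟩, hμ, hR⟩ := hinv.reversible.exists_dilation ha hh hM
  obtain ⟨h1, h2⟩ := dilation_dimension_bounds hV hμ hR
  obtain rfl : e = h := le_antisymm
    (Nat.le_of_mul_le_mul_left (by linarith) ha) (Nat.le_of_mul_le_mul_left h1 ha)
  have hV' : V * Vᴴ = 1 := mul_eq_one_comm.1 hV
  have ha0 : (a : ℂ) ≠ 0 := by exact_mod_cast (by omega : a ≠ 0)
  have hμ1 : ∀ f, μ f = 1 := fun f => by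
    have e1 : ∑ i, ((rearrange V)ᴴ * rearrange V) (i, f) (i, f) = a * μ f := by
      simp [hR, kroneckerMap_apply]
    have e2 : ∑ j, (V * Vᴴ) (j, f) (j, f) = a := by
      simp [hV']
    rw [← mul_right_inj' ha0, mul_one, ← e1, ← e2]
    simp only [rearrange_gram]
    simp only [Matrix.mul_apply, conjTranspose_apply, Fintype.sum_prod_type]
    conv_rhs => rw [Finset.sum_comm]
    refine Finset.sum_congr rfl fun i _ => ?_
    conv_rhs => rw [Finset.sum_comm]
    exact Finset.sum_congr rfl fun k _ => Finset.sum_congr rfl fun j _ => mul_comm _ _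
  have hR1 : (rearrange V)ᴴ * rearrange V = 1 := by
    rw [hR, funext hμ1]
    simp
  refine ⟨V, hV, hV', hdil, hR1, ?_⟩
  exact (mul_eq_one_comm_of_card_eq _ _ _ (by simp [mul_comm])).1 hR1

/-- The dilation of the inverse channel: `W_{(i,g),(j,k)} = conj V_{(j,g),(i,k)}`. -/
def inverseDilation {a b h : ℕ} (V : Matrix (Fin b × Fin h) (Fin a × Fin h) ℂ) :
    Matrix (Fin a × Fin h) (Fin b × Fin h) ℂ :=
  of fun p q => star (V (q.1, p.2) (p.1, q.2))

lemma inverseDilation_inverseDilation {a b h : ℕ} (V : Matrix (Fin b × Fin h) (Fin a × Fin h) ℂ) :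
    inverseDilation (inverseDilation V) = V := by
  ext p q
  simp [inverseDilation]

lemma entLeftInv_of_rearrange_isometry {a b h : ℕ} (hh : 1 ≤ h)
    {V : Matrix (Fin b × Fin h) (Fin a × Fin h) ℂ} (hR : (rearrange V)ᴴ * rearrange V = 1) :
    EntLeftInv (∑ f, conjBy (slice V f)) (∑ g, conjBy (slice (inverseDilation V) g)) (canME h) := by
  intro x
  have hh0 : (h : ℂ) ≠ 0 := by exact_mod_cast (by omega : h ≠ 0)
  have hT : ∀ g f, slice (inverseDilation V) g * encodeKraus (slice V f) =
      (if g = f then ((Real.sqrt h : ℝ) : ℂ)⁻¹ else 0) • (1 : Mat (Fin a)) := fun g f => by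
    ext p i
    have h1 := rearrange_gram V (p, g) (i, f)
    rw [hR] at h1
    rw [Matrix.mul_apply, Fintype.sum_prod_type, Finset.sum_comm]
    simp only [slice, inverseDilation, encodeKraus, of_apply, mul_left_comm _ (_⁻¹ : ℂ),
      ← Finset.mul_sum]
    rw [← h1]
    by_cases hgf : g = f <;> by_cases hpi : p = i <;> simp [one_apply, hgf, hpi]
  rw [apply_amplR_tensorState_canME, LinearMap.sum_apply, Fintype.sum_prod_type]
  have : ∀ g f : Fin h, conjBy ((if g = f then ((Real.sqrt h : ℝ) : ℂ)⁻¹ else 0) •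
      (1 : Mat (Fin a))) x = if g = f then (h : ℂ)⁻¹ • x else 0 := fun g f => by
    split_ifs <;> simp [conjBy, smul_smul, ← inv_sqrt_mul_self]
  simp only [hT, this]
  simp [hh0, ← Nat.cast_smul_eq_nsmul ℂ, smul_smul]

lemma entInvertible_of_biunitary {a b h : ℕ} (hh : 1 ≤ h)
    {M : Mat (Fin a × Fin h) →ₗ[ℂ] Mat (Fin b)}
    {V : Matrix (Fin b × Fin h) (Fin a × Fin h) ℂ} (hV : V * Vᴴ = 1)
    (hM : ∀ z : Mat (Fin a × Fin h), M z = ptraceSnd (V * z * Vᴴ))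
    (hR : (rearrange V)ᴴ * rearrange V = 1) (hR' : rearrange V * (rearrange V)ᴴ = 1) :
    EntInvertible M (canME h) := by
  have hM' : M = ∑ f, conjBy (slice V f) :=
    LinearMap.ext fun z => (hM z).trans (ptraceSnd_conj V z)
  subst hM'
  refine ⟨∑ g, conjBy (slice (inverseDilation V) g), isChannel_sum_conjBy ?_,
    entLeftInv_of_rearrange_isometry hh hR, fun y => ?_⟩
  · ext p q
    have h1 := congrFun (congrFun hR' (p.2, p.1)) (q.2, q.1)
    simp only [Matrix.mul_apply, Fintype.sum_prod_type, rearrange, of_apply,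
      conjTranspose_apply] at h1
    simp only [Matrix.sum_apply, Matrix.mul_apply, slice, inverseDilation, of_apply,
      conjTranspose_apply, star_star]
    rw [Finset.sum_comm, h1]
    simp [one_apply, Prod.ext_iff, and_comm]
  · have hW : (rearrange (inverseDilation V))ᴴ * rearrange (inverseDilation V) = 1 := by
      rw [← hV]
      ext p q
      simp only [rearrange_gram, inverseDilation, of_apply, star_star]
      simp only [Matrix.mul_apply, Fintype.sum_prod_type, conjTranspose_apply]
      exact Finset.sum_comm
    have := entLeftInv_of_rearrange_isometry hh hW y
    rwa [inverseDilation_inverseDilation, ← swapState_canME] at this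

/-- **Biunitarity characterisation of entanglement-invertibility with respect to
the canonical maximally entangled state.** A channel `M : M_a(ℂ) ⊗ M_h(ℂ) → M_b(ℂ)`
is entanglement-invertible with respect to `|Ω_h⟩⟨Ω_h|` iff it has a unitary
dilation `V` whose rearrangement `Ṽ` is also unitary (a biunitary). In particular
entanglement-invertibility forces `a = b`. -/
theorem biunitary_characterisation
    (a b h : ℕ) (ha : 1 ≤ a) (hb : 1 ≤ b) (hh : 1 ≤ h)
    (M : Mat (Fin a × Fin h) →ₗ[ℂ] Mat (Fin b)) (hM : IsChannel M) :
    (EntInvertible M (canME h) ↔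
      ∃ V : Matrix (Fin b × Fin h) (Fin a × Fin h) ℂ,
        Vᴴ * V = 1 ∧ V * Vᴴ = 1 ∧
        (∀ z : Mat (Fin a × Fin h), M z = ptraceSnd (V * z * Vᴴ)) ∧
        (rearrange V)ᴴ * rearrange V = 1 ∧ rearrange V * (rearrange V)ᴴ = 1) ∧
    (EntInvertible M (canME h) → a = b) := by
  exact ⟨⟨fun hinv => hinv.exists_biunitary ha hb hh hM, fun ⟨_, _, hV, hdil, hR, hR'⟩ =>
    entInvertible_of_biunitary hh hV hdil hR hR'⟩, fun hinv => hinv.dim_eq ha hb hh hM⟩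

end EntInvPaper
end
end
end

section
/- Characterisation of entanglement-reversibility with respect to a mixed resource state (matrix-algebra case). Let a, b, h, h₂, e ≥ 1 and R ≥ 1. Let ω_r : ℂ^h → ℂ^{h₂} (r < R) be linear maps with ∑_{r<R} Tr(ω_r†ω_r) = 1, and let W := ∑_{r<R} |w_r⟩⟨w_r| ∈ M_h(ℂ)⊗M_{h₂}(ℂ) be the state with w_r := ∑_{k<h} e_k⊗ω_r e_k. Let M : M_a(ℂ)⊗M_h(ℂ) → M_b(ℂ) be a channel with minimal Stinespring dilation V : ℂ^a⊗ℂ^h → ℂ^b⊗ℂ^e, and let Ṽ : ℂ^a⊗ℂ^e → ℂ^h⊗ℂ^b be the rearrangement with standard-basis entries Ṽ_{(k,j),(i,f)} := V_{(j,f),(i,k)}. Then M is entanglement-reversible with respect to W if and only if for every pair r, r' < R there exists a matrix ν_{r,r'} ∈ M_e(ℂ) such that Ṽ†·(ω_r†ω_{r'} ⊗ I_b)·Ṽ = I_a ⊗ ν_{r,r'}. -/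
noncomputable section

open Matrix Kronecker
open scoped ComplexOrder

noncomputable section
open Matrix Kronecker
open scoped ComplexOrder
namespace EntInvPaper

/-- The linear map `X ↦ ∑ₜ Lₜ X Lₜ†` with Kraus family `L`. -/
def krausMap {n m s : Type} [Fintype n] [Fintype s] (L : s → Matrix m n ℂ) :
    Mat n →ₗ[ℂ] Mat m :=
  ∑ t, conjBy (L t)

lemma krausMap_apply {n m s : Type} [Fintype n] [Fintype s] (L : s → Matrix m n ℂ) (X : Mat n) :
    krausMap L X = ∑ t, L t * X * (L t)ᴴ := by
  simp [krausMap, LinearMap.sum_apply, conjBy]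

lemma amplL_krausMap {n m s : Type} [Fintype n] [Fintype s] (k : ℕ)
    (L : s → Matrix m n ℂ) (X : Mat (Fin k × n)) :
    amplL (Fin k) (krausMap L) X =
      ∑ t, ((1 : Mat (Fin k)) ⊗ₖ L t) * X * ((1 : Mat (Fin k)) ⊗ₖ L t)ᴴ := by
  ext ⟨p, i⟩ ⟨q, j⟩
  simp only [amplL, krausMap_apply, Matrix.of_apply, Matrix.sum_apply, Matrix.mul_apply,
    Matrix.conjTranspose_apply, Matrix.kroneckerMap_apply, Matrix.one_apply,
    Fintype.sum_prod_type, ite_mul, one_mul, zero_mul, Finset.sum_ite_irrel,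
    Finset.sum_const_zero, Finset.sum_ite_eq, Finset.mem_univ, if_true, apply_ite star, star_zero,
    mul_ite, mul_zero]

lemma isChannel_krausMap {n m s : Type} [Fintype n] [DecidableEq n] [Fintype m] [Fintype s]
    {L : s → Matrix m n ℂ} (hL : ∑ t, (L t)ᴴ * L t = 1) : IsChannel (krausMap L) := by
  refine ⟨fun k X hX => ?_, fun X => ?_⟩
  · rw [amplL_krausMap]
    exact Matrix.posSemidef_sum _ fun t _ => hX.mul_mul_conjTranspose_same _
  · calc (krausMap L X).trace = ∑ t, (L t * X * (L t)ᴴ).trace := by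
          rw [krausMap_apply, Matrix.trace_sum]
      _ = ∑ t, ((L t)ᴴ * L t * X).trace :=
          Finset.sum_congr rfl fun t _ => Matrix.trace_mul_cycle _ _ _
      _ = X.trace := by rw [← Matrix.trace_sum, ← Finset.sum_mul, hL, Matrix.one_mul]

open scoped MatrixOrder in
/-- Theorem of Choi: a channel has a Kraus decomposition. -/
lemma IsChannel.exists_kraus {n m : Type} [Fintype n] [DecidableEq n] [Fintype m] [DecidableEq m]
    {N : Mat n →ₗ[ℂ] Mat m} (hN : IsChannel N) :
    ∃ (s : Type) (_ : Fintype s) (L : s → Matrix m n ℂ),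
      ∑ t, (L t)ᴴ * L t = 1 ∧ N = krausMap L := by
  let σ := (Fintype.equivFin n).symm
  let v : Fin (Fintype.card n) × n → ℂ := fun p => if σ p.1 = p.2 then 1 else 0
  have hv : (vecMulVec v (star v)).PosSemidef := Matrix.posSemidef_vecMulVec_self_star v
  obtain ⟨B, hB⟩ := CStarAlgebra.nonneg_iff_eq_star_mul_self.mp (hN.1 _ _ hv).nonneg
  rw [Matrix.star_eq_conjTranspose] at hB
  let L : Fin (Fintype.card n) × m → Matrix m n ℂ :=
    fun t => Matrix.of fun i x => star (B t (σ.symm x, i))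
  have hNL : N = krausMap L := by
    refine Matrix.ext_linearMap _ fun x y => LinearMap.ext_ring ?_
    ext i j
    have h := congrFun (congrFun hB (σ.symm x, i)) (σ.symm y, j)
    have hs : (Matrix.of fun x' y' => vecMulVec v (star v) (σ.symm x, x') (σ.symm y, y'))
        = Matrix.single x y (1 : ℂ) := by
      ext x' y'
      simp only [Matrix.of_apply, Matrix.vecMulVec_apply, v, Pi.star_apply, Matrix.single_apply,
        Equiv.apply_symm_apply]
      split_ifs <;> simp_all
    simp only [amplL, Matrix.of_apply, hs] at h
    change N (Matrix.single x y 1) i j = krausMap L (Matrix.single x y 1) i j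
    rw [h, krausMap_apply]
    simp [Matrix.sum_apply, Matrix.mul_apply, L, Matrix.single_apply, ite_and]
  refine ⟨_, inferInstance, L, ?_, hNL⟩
  refine Matrix.ext_iff_trace_mul_right.mpr fun X => ?_
  rw [Matrix.one_mul, ← hN.2 X, hNL, krausMap_apply, Matrix.trace_sum, Finset.sum_mul,
    Matrix.trace_sum]
  exact Finset.sum_congr rfl fun t _ => (Matrix.trace_mul_cycle _ _ _).symm

lemma eq_zero_of_sum_mul_star_eq_zero {s : Type} [Fintype s] {f : s → ℂ}
    (hf : ∑ t, f t * star (f t) = 0) (t : s) : f t = 0 := by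
  have h := (Finset.sum_eq_zero_iff_of_nonneg
    (fun t _ => mul_star_self_nonneg (f t))).mp hf t (Finset.mem_univ t)
  simpa using h

/-- The Kraus operators of the identity channel are scalar. -/
lemma exists_smul_one_of_krausMap_eq_id {n s : Type} [Fintype n] [DecidableEq n] [Fintype s]
    (i₀ : n) {A : s → Mat n} (hA : ∀ x, ∑ t, A t * x * (A t)ᴴ = x) (t : s) :
    A t = A t i₀ i₀ • 1 := by
  have key : ∀ p i q j, ∑ t, A t p i * star (A t q j) = if i = p ∧ j = q then 1 else 0 := by
    intro p i q j
    have h := congrFun (congrFun (hA (Matrix.single i j 1)) p) q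
    simpa [Matrix.sum_apply, Matrix.mul_apply, Matrix.single_apply, ite_and,
      Finset.sum_ite_irrel] using h
  ext p i
  by_cases hpi : p = i
  · subst hpi
    have h : ∑ t, (A t p p - A t i₀ i₀) * star (A t p p - A t i₀ i₀) = 0 := by
      simp only [star_sub, sub_mul, mul_sub, Finset.sum_sub_distrib, key]
      simp
    simpa [sub_eq_zero] using eq_zero_of_sum_mul_star_eq_zero h t
  · have h : ∑ t, A t p i * star (A t p i) = 0 := by rw [key]; simp [Ne.symm hpi]
    simpa [Matrix.one_apply, hpi] using eq_zero_of_sum_mul_star_eq_zero h t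

/-- If the Kraus operators satisfy the Knill–Laflamme conditions, a recovery family exists. -/
lemma exists_recovery_of_knillLaflamme {n m s : Type} [Fintype n] [DecidableEq n] [Fintype m]
    [DecidableEq m] [Fintype s] [DecidableEq s] (i₀ : m) {K : s → Matrix n m ℂ} {l : Mat s}
    (hK : ∀ r r', (K r)ᴴ * K r' = l r r' • 1) :
    ∃ L : s ⊕ n → Matrix m n ℂ, ∑ t, (L t)ᴴ * L t = 1 ∧
      ∀ t r, ∃ c : ℂ, L t * K r = c • 1 := by
  have hl : l.IsHermitian := by
    ext r r'
    have h := congrArg conjTranspose (hK r' r)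
    rw [Matrix.conjTranspose_mul, Matrix.conjTranspose_conjTranspose, hK] at h
    simpa using (congrFun (congrFun h i₀) i₀).symm
  let U : Mat s := hl.eigenvectorUnitary
  let d := hl.eigenvalues
  have hUU : U * Uᴴ = 1 := (Matrix.mem_unitaryGroup_iff).mp hl.eigenvectorUnitary.2
  have hUlU : Uᴴ * l * U = diagonal (fun t => (d t : ℂ)) := by
    have hUU' : Uᴴ * U = 1 := (Matrix.mem_unitaryGroup_iff').mp hl.eigenvectorUnitary.2
    have hspec : l = U * diagonal (fun t => (d t : ℂ)) * Uᴴ := by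
      have h := hl.spectral_theorem
      rwa [Unitary.conjStarAlgAut_apply] at h
    calc Uᴴ * l * U = (Uᴴ * U) * diagonal (fun t => (d t : ℂ)) * (Uᴴ * U) := by
          conv_lhs => rw [hspec]
          simp only [Matrix.mul_assoc]
      _ = _ := by rw [hUU', Matrix.one_mul, Matrix.mul_one]
  let F : s → Matrix n m ℂ := fun t => ∑ r, U r t • K r
  have hKF : ∀ r, K r = ∑ t, star (U r t) • F t := by
    intro r
    have h : ∀ r', ∑ t, star (U r t) * U r' t = if r' = r then 1 else 0 := by
      intro r'
      have h := congrFun (congrFun hUU r') r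
      simpa [Matrix.mul_apply, Matrix.one_apply, mul_comm] using h
    simp only [F, Finset.smul_sum, smul_smul]
    rw [Finset.sum_comm]
    simp only [← Finset.sum_smul, h]
    simp
  have hFF : ∀ t t', (F t)ᴴ * F t' = (if t = t' then (d t : ℂ) else 0) • 1 := by
    intro t t'
    have h := congrFun (congrFun hUlU t) t'
    rw [Matrix.diagonal_apply] at h
    rw [← h]
    simp only [F, Matrix.conjTranspose_sum, Matrix.conjTranspose_smul, Matrix.sum_mul,
      Matrix.mul_sum, Matrix.smul_mul, Matrix.mul_smul, hK, smul_smul, Matrix.mul_apply,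
      Matrix.conjTranspose_apply, Finset.sum_smul, Finset.sum_mul, Finset.smul_sum]
    refine Finset.sum_congr rfl fun _ _ => Finset.sum_congr rfl fun _ _ => ?_
    congr 1
    ring
  have hd : ∀ t, 0 ≤ d t := by
    intro t
    have h := (Matrix.posSemidef_conjTranspose_mul_self (F t)).diag_nonneg (i := i₀)
    rw [hFF] at h
    simpa using h
  have hF0 : ∀ t, d t = 0 → F t = 0 := by
    intro t ht
    have h := hFF t t
    rw [ht] at h
    exact Matrix.conjTranspose_mul_self_eq_zero.mp (by simpa using h)
  let c : s → ℝ := fun t => (√(d t))⁻¹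
  have hc : ∀ t, (c t : ℂ) * c t * d t = if d t = 0 then 0 else 1 := by
    intro t
    split_ifs with ht
    · simp [ht]
    · have h : c t * c t * d t = 1 := by
        simp only [c]
        rw [← mul_inv, Real.mul_self_sqrt (hd t), inv_mul_cancel₀ ht]
      exact_mod_cast h
  let G : s → Matrix n m ℂ := fun t => (c t : ℂ) • F t
  let P : Mat n := ∑ t, G t * (G t)ᴴ
  have hP : Pᴴ = P := by simp [P, Matrix.conjTranspose_sum]
  have hGF : ∀ t t', (G t)ᴴ * F t' = (if t = t' then (c t : ℂ) * d t else 0) • 1 := by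
    intro t t'
    rw [Matrix.conjTranspose_smul, Matrix.smul_mul, hFF, smul_smul]
    simp
  have hPF : ∀ t, P * F t = F t := by
    intro t
    have h : P * F t = ((c t : ℂ) * c t * d t) • F t := by
      simp only [P, Matrix.sum_mul, Matrix.mul_assoc, hGF, Matrix.mul_smul, Matrix.mul_one]
      simp only [ite_smul, zero_smul, Finset.sum_ite_eq', Finset.mem_univ, if_true]
      simp only [G, smul_smul]
      congr 1
      ring
    rw [h, hc]
    split_ifs with ht
    · rw [hF0 t ht, smul_zero]
    · rw [one_smul]
  have hPP : P * P = P := by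
    have hPG : ∀ t, P * G t = G t := fun t => by simp only [G, Matrix.mul_smul, hPF]
    calc P * P = ∑ t, P * G t * (G t)ᴴ := by
          conv_lhs => arg 2; simp only [P]
          simp only [Matrix.mul_sum, Matrix.mul_assoc]
      _ = P := by simp only [hPG, P]
  refine ⟨Sum.elim (fun t => (G t)ᴴ) fun x => Matrix.single i₀ x (1 : ℂ) * (1 - P), ?_, ?_⟩
  · have hQ : ∑ x : n, (Matrix.single x i₀ (1 : ℂ) * Matrix.single i₀ x (1 : ℂ) : Mat n) = 1 := by
      simp [Matrix.single_mul_single_same, Matrix.sum_single_one]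
    have hQ' : ∑ x : n, (Matrix.single i₀ x (1 : ℂ) * (1 - P))ᴴ *
        (Matrix.single i₀ x (1 : ℂ) * (1 - P)) = 1 - P := by
      calc _ = ∑ x : n, (1 - P) * (Matrix.single x i₀ (1 : ℂ) * Matrix.single i₀ x (1 : ℂ))
              * (1 - P) := by
            refine Finset.sum_congr rfl fun x _ => ?_
            rw [Matrix.conjTranspose_mul, Matrix.conjTranspose_sub, hP, Matrix.conjTranspose_one,
              Matrix.conjTranspose_single, star_one]
            simp only [Matrix.mul_assoc]
        _ = (1 - P) * (1 - P) := by
            rw [← Matrix.sum_mul, ← Matrix.mul_sum, hQ, Matrix.mul_one]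
        _ = 1 - P := by
            rw [Matrix.sub_mul, Matrix.one_mul, Matrix.mul_sub, Matrix.mul_one, hPP, sub_self,
              sub_zero]
    rw [Fintype.sum_sum_type]
    simp only [Sum.elim_inl, Sum.elim_inr, hQ', Matrix.conjTranspose_conjTranspose]
    exact add_sub_cancel P 1
  · rintro (t | x) r
    · refine ⟨star (U r t) * (c t * d t), ?_⟩
      simp only [Sum.elim_inl]
      rw [hKF r]
      simp [Matrix.mul_sum, hGF, smul_smul, ite_smul]
    · refine ⟨0, ?_⟩
      have hPK : P * K r = K r := by
        rw [hKF r, Matrix.mul_sum]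
        simp only [Matrix.mul_smul, hPF]
      rw [Sum.elim_inr, Matrix.mul_assoc, Matrix.sub_mul, hPK]
      simp

/-- Knill–Laflamme: a channel given by Kraus operators has a left inverse channel iff all the
products of an adjoint `Kᵣ†` with some `Kₛ` are scalar. -/
lemma exists_leftInverse_iff_knillLaflamme {n m s : Type} [Fintype n] [DecidableEq n] [Fintype m]
    [DecidableEq m] [Nonempty m] [Fintype s] {K : s → Matrix n m ℂ}
    (hKtr : ∑ r, (K r)ᴴ * K r = 1) :
    (∃ N : Mat n →ₗ[ℂ] Mat m, IsChannel N ∧ ∀ x, N (∑ r, K r * x * (K r)ᴴ) = x) ↔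
      ∀ r r', ∃ c : ℂ, (K r)ᴴ * K r' = c • 1 := by
  classical
  obtain ⟨i₀⟩ := ‹Nonempty m›
  have hcomp : ∀ {t : Type} [Fintype t] (L : t → Matrix m n ℂ) (x : Mat m),
      krausMap L (∑ r, K r * x * (K r)ᴴ) = ∑ u : t × s, (L u.1 * K u.2) * x * (L u.1 * K u.2)ᴴ := by
    intro t _ L x
    simp only [krausMap_apply, Fintype.sum_prod_type, Matrix.mul_sum, Matrix.sum_mul,
      Matrix.conjTranspose_mul, Matrix.mul_assoc]
  have hgram : ∀ {t : Type} [Fintype t] {L : t → Matrix m n ℂ}, ∑ u, (L u)ᴴ * L u = 1 →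
      ∀ r r', (K r)ᴴ * K r' = ∑ u, (L u * K r)ᴴ * (L u * K r') := by
    intro t _ L hL r r'
    calc (K r)ᴴ * K r' = (K r)ᴴ * (∑ u, (L u)ᴴ * L u) * K r' := by rw [hL, Matrix.mul_one]
      _ = _ := by
        simp only [Matrix.mul_sum, Matrix.sum_mul, Matrix.conjTranspose_mul, Matrix.mul_assoc]
  constructor
  · rintro ⟨N, hN, hinv⟩ r r'
    obtain ⟨t, _, L, hL, rfl⟩ := hN.exists_kraus
    have hsc := exists_smul_one_of_krausMap_eq_id i₀
      (A := fun u : t × s => L u.1 * K u.2) (fun x => by rw [← hcomp, hinv])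
    refine ⟨∑ u, star ((L u * K r) i₀ i₀) * (L u * K r') i₀ i₀, ?_⟩
    rw [hgram hL, Finset.sum_smul]
    refine Finset.sum_congr rfl fun u _ => ?_
    conv_lhs => rw [hsc (u, r), hsc (u, r')]
    simp [smul_smul, mul_comm]
  · intro hK
    choose l hl using hK
    obtain ⟨L, hL, hc⟩ := exists_recovery_of_knillLaflamme i₀ (l := Matrix.of l) hl
    choose c hc using hc
    refine ⟨krausMap L, isChannel_krausMap hL, fun x => ?_⟩
    have hone : (∑ u : (s ⊕ n) × s, star (c u.1 u.2) * c u.1 u.2) • (1 : Mat m) = 1 := by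
      refine Eq.trans ?_ hKtr
      simp only [hgram hL, hc, Matrix.conjTranspose_smul, Matrix.conjTranspose_one,
        Matrix.smul_mul, Matrix.mul_smul, Matrix.one_mul, smul_smul, ← Finset.sum_smul]
      rw [Fintype.sum_prod_type_right]
      simp only [mul_comm]
    have hsum : ∑ u : (s ⊕ n) × s, star (c u.1 u.2) * c u.1 u.2 = 1 := by
      simpa using congrFun (congrFun hone i₀) i₀
    rw [hcomp]
    simp only [hc, Matrix.conjTranspose_smul, Matrix.conjTranspose_one, Matrix.smul_mul,
      Matrix.mul_smul, Matrix.one_mul, Matrix.mul_one, smul_smul]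
    rw [← Finset.sum_smul, hsum, one_smul]

/-- The Kraus operators of `x ↦ (M ⊗ id)(x ⊗ W)` for `W = ∑ᵣ |w_r⟩⟨w_r|`, in terms of a
dilation `V` of `M`. -/
def resourceKraus {a b h h₂ e R : ℕ} (ω : Fin R → Matrix (Fin h₂) (Fin h) ℂ)
    (V : Matrix (Fin b × Fin e) (Fin a × Fin h) ℂ) (s : Fin R × Fin e) :
    Matrix (Fin b × Fin h₂) (Fin a) ℂ :=
  Matrix.of fun p i => ∑ k, ω s.1 p.2 k * V (p.1, s.2) (i, k)

lemma amplR_tensorState_eq_sum_resourceKraus {a b h h₂ e R : ℕ}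
    (ω : Fin R → Matrix (Fin h₂) (Fin h) ℂ) {M : Mat (Fin a × Fin h) →ₗ[ℂ] Mat (Fin b)}
    {V : Matrix (Fin b × Fin e) (Fin a × Fin h) ℂ} (hdil : IsDilation M V) (x : Mat (Fin a)) :
    amplR (Fin h₂) M (tensorState x (∑ r, pureState (ω r))) =
      ∑ s, resourceKraus ω V s * x * (resourceKraus ω V s)ᴴ := by
  ext ⟨j, l⟩ ⟨j', l'⟩
  simp only [amplR, Matrix.of_apply, hdil.2, ptraceSnd, tensorState, Matrix.reindex_apply,
    Matrix.submatrix_apply, Equiv.symm_symm, Equiv.prodAssoc_apply, Matrix.kroneckerMap_apply,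
    Matrix.sum_apply, pureState, outer, pureVec, Matrix.vecMulVec_apply, Pi.star_apply,
    Matrix.mul_apply, Matrix.conjTranspose_apply, resourceKraus, Fintype.sum_prod_type,
    Finset.mul_sum, Finset.sum_mul, star_sum, star_mul']
  iterate 5
    conv_rhs => rw [Finset.sum_comm]
    refine Finset.sum_congr rfl fun _ _ => ?_
  refine Finset.sum_congr rfl fun _ _ => ?_
  ring

lemma rearrange_gram_apply {a b h h₂ e R : ℕ} (ω : Fin R → Matrix (Fin h₂) (Fin h) ℂ)
    (V : Matrix (Fin b × Fin e) (Fin a × Fin h) ℂ) (r r' : Fin R) (i i' : Fin a) (f f' : Fin e) :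
    ((rearrange V)ᴴ * ((((ω r)ᴴ * ω r') ⊗ₖ (1 : Mat (Fin b))) * rearrange V)) (i, f) (i', f') =
      ((resourceKraus ω V (r, f))ᴴ * resourceKraus ω V (r', f')) i i' := by
  have h : (rearrange V)ᴴ * ((((ω r)ᴴ * ω r') ⊗ₖ (1 : Mat (Fin b))) * rearrange V) =
      ((ω r ⊗ₖ (1 : Mat (Fin b))) * rearrange V)ᴴ * ((ω r' ⊗ₖ (1 : Mat (Fin b))) * rearrange V) := by
    rw [Matrix.conjTranspose_mul, Matrix.conjTranspose_kronecker, Matrix.conjTranspose_one,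
      ← Matrix.one_mul (1 : Mat (Fin b)), Matrix.mul_kronecker_mul]
    simp only [Matrix.one_mul, Matrix.mul_assoc]
  have hent : ∀ r l j i f, ((ω r ⊗ₖ (1 : Mat (Fin b))) * rearrange V) (l, j) (i, f) =
      resourceKraus ω V (r, f) (j, l) i := by
    intro r l j i f
    simp [Matrix.mul_apply, rearrange, resourceKraus, Fintype.sum_prod_type, Matrix.one_apply]
  rw [h]
  rw [Matrix.mul_apply, Matrix.mul_apply]
  simp only [Matrix.conjTranspose_apply, Fintype.sum_prod_type, hent]
  exact Finset.sum_comm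

lemma sum_resourceKraus_gram {a b h h₂ e R : ℕ} {ω : Fin R → Matrix (Fin h₂) (Fin h) ℂ}
    (hωtr : ∑ r, ((ω r)ᴴ * ω r).trace = 1)
    {V : Matrix (Fin b × Fin e) (Fin a × Fin h) ℂ} (hV : Vᴴ * V = 1) :
    ∑ s, (resourceKraus ω V s)ᴴ * resourceKraus ω V s = 1 := by
  ext i i'
  have rot : ∀ {n : ℕ} (A : Fin e → Fin b → Fin n → ℂ),
      ∑ f, ∑ j, ∑ l, A f j l = ∑ l, ∑ f, ∑ j, A f j l := fun A =>
    (Finset.sum_congr rfl fun _ _ => Finset.sum_comm).trans Finset.sum_comm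
  have hV' : ∀ k k', ∑ f, ∑ j, star (V (j, f) (i, k)) * V (j, f) (i', k') =
      if k = k' then (1 : Mat (Fin a)) i i' else 0 := by
    intro k k'
    have h := congrFun (congrFun hV (i, k)) (i', k')
    rw [Matrix.mul_apply, Fintype.sum_prod_type_right] at h
    simp only [Matrix.conjTranspose_apply] at h
    rw [h]
    simp only [Matrix.one_apply, Prod.mk.injEq, ite_and]
    split_ifs <;> rfl
  calc _ = ∑ r, ∑ l, ∑ k', ∑ k, star (ω r l k) * ω r l k' *
        ∑ f, ∑ j, star (V (j, f) (i, k)) * V (j, f) (i', k') := by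
        simp only [Matrix.mul_apply, Matrix.sum_apply, Matrix.conjTranspose_apply, resourceKraus,
          Matrix.of_apply, Fintype.sum_prod_type, star_sum, star_mul', Finset.mul_sum,
          Finset.sum_mul]
        refine Finset.sum_congr rfl fun _ _ => ?_
        iterate 3 refine (rot _).trans (Finset.sum_congr rfl fun _ _ => ?_)
        refine Finset.sum_congr rfl fun _ _ => Finset.sum_congr rfl fun _ _ => ?_
        ring
    _ = (∑ r, ((ω r)ᴴ * ω r).trace) * (1 : Mat (Fin a)) i i' := by
        simp only [hV', mul_ite, mul_zero, Finset.sum_ite_eq', Finset.mem_univ, if_true,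
          Matrix.trace, Matrix.diag_apply, Matrix.mul_apply, Matrix.conjTranspose_apply,
          Finset.sum_mul]
        exact Finset.sum_congr rfl fun _ _ => Finset.sum_comm
    _ = _ := by rw [hωtr, one_mul]

/-- **Characterisation of entanglement-reversibility with respect to a mixed
resource state (matrix-algebra case).** Writing the state as a sum of (unnormalised)
pure states defined by maps `ω_r`, the channel `M` with minimal dilation `V` is
entanglement-reversible w.r.t. `W = ∑ᵣ |w_r⟩⟨w_r|` iff for all `r, r'` there is
`ν_{r,r'} ∈ M_e(ℂ)` with `Ṽ†·(ω_r† ω_{r'} ⊗ I_b)·Ṽ = I_a ⊗ ν_{r,r'}`. -/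
theorem mixed_state_entanglement_reversibility
    (a b h h₂ e R : ℕ) (ha : 1 ≤ a) (hb : 1 ≤ b) (hh : 1 ≤ h) (hh₂ : 1 ≤ h₂)
    (he : 1 ≤ e) (hR : 1 ≤ R)
    (ω : Fin R → Matrix (Fin h₂) (Fin h) ℂ)
    (hωtr : ∑ r, ((ω r)ᴴ * ω r).trace = 1)
    (M : Mat (Fin a × Fin h) →ₗ[ℂ] Mat (Fin b)) (hM : IsChannel M)
    (V : Matrix (Fin b × Fin e) (Fin a × Fin h) ℂ)
    (hdil : IsDilation M V) (hmin : IsMinimalDilation V) :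
    EntReversible M (∑ r, pureState (ω r)) ↔
      ∀ r r' : Fin R, ∃ ν : Mat (Fin e),
        (rearrange V)ᴴ * ((((ω r)ᴴ * ω r') ⊗ₖ (1 : Mat (Fin b))) * rearrange V)
          = (1 : Mat (Fin a)) ⊗ₖ ν := by
  have : Nonempty (Fin a) := ⟨⟨0, ha⟩⟩
  have hKL := exists_leftInverse_iff_knillLaflamme (sum_resourceKraus_gram hωtr hdil.1)
  simp only [← amplR_tensorState_eq_sum_resourceKraus ω hdil] at hKL
  refine hKL.trans ⟨fun hK r r' => ?_, fun hν s s' => ?_⟩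
  · choose c hc using hK
    refine ⟨Matrix.of fun f f' => c (r, f) (r', f'), ?_⟩
    ext ⟨i, f⟩ ⟨i', f'⟩
    rw [rearrange_gram_apply, hc]
    simp [mul_comm]
  · obtain ⟨ν, hν⟩ := hν s.1 s'.1
    refine ⟨ν s.2 s'.2, ?_⟩
    ext i i'
    rw [← rearrange_gram_apply, hν]
    simp [mul_comm]

end EntInvPaper
end
end
end

section
/- Dimension bound for entanglement-reversible channels. Let A = ∏_{i<m} M_{a_i}(ℂ) and B = ∏_{j<n} M_{b_j}(ℂ) be multimatrix algebras (all a_i, b_j ≥ 1), let h₁, h₂ ≥ 1, and let W ∈ M_{h₁}(ℂ)⊗M_{h₂}(ℂ) be any state. If there exists a channel M : A⊗M_{h₁}(ℂ) → B which is entanglement-reversible with respect to W, then dim A ≤ dim B, i.e. ∑_{i<m} a_i² ≤ ∑_{j<n} b_j². -/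
noncomputable section

open Matrix Kronecker
open scoped ComplexOrder

noncomputable section

open Matrix Kronecker
open scoped ComplexOrder

namespace EntInvPaper

/-- Amplification `Φ ⊗ id_{M_t}` for a linear map between multimatrix algebras. -/
def piAmplR {ι κ : Type} {A : ι → Type} {B : κ → Type} (t : Type)
    (Φ : ((i : ι) → Mat (A i)) →ₗ[ℂ] (j : κ) → Mat (B j))
    (X : (i : ι) → Mat (A i × t)) : (j : κ) → Mat (B j × t) :=
  fun j => Matrix.of fun p q =>
    Φ (fun i => Matrix.of fun x y => X i (x, p.2) (y, q.2)) j p.1 q.1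

/-- Amplification `id_{M_t} ⊗ Φ` for a linear map between multimatrix algebras. -/
def piAmplL {ι κ : Type} {A : ι → Type} {B : κ → Type} (t : Type)
    (Φ : ((i : ι) → Mat (A i)) →ₗ[ℂ] (j : κ) → Mat (B j))
    (X : (i : ι) → Mat (t × A i)) : (j : κ) → Mat (t × B j) :=
  fun j => Matrix.of fun p q =>
    Φ (fun i => Matrix.of fun x y => X i (p.1, x) (q.1, y)) j p.2 q.2

/-- Complete positivity for maps between multimatrix algebras. -/
def PiIsCP {ι κ : Type} {A : ι → Type} {B : κ → Type}
    [∀ i, Fintype (A i)] [∀ j, Fintype (B j)]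
    (Φ : ((i : ι) → Mat (A i)) →ₗ[ℂ] (j : κ) → Mat (B j)) : Prop :=
  ∀ (k : ℕ) (X : (i : ι) → Mat (Fin k × A i)),
    (∀ i, (X i).PosSemidef) → ∀ j, (piAmplL (Fin k) Φ X j).PosSemidef

/-- A channel between multimatrix algebras: completely positive and preserving
the total trace. -/
def PiIsChannel {ι κ : Type} [Fintype ι] [Fintype κ] {A : ι → Type} {B : κ → Type}
    [∀ i, Fintype (A i)] [∀ j, Fintype (B j)]
    (Φ : ((i : ι) → Mat (A i)) →ₗ[ℂ] (j : κ) → Mat (B j)) : Prop :=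
  PiIsCP Φ ∧ ∀ X, ∑ j, (Φ X j).trace = ∑ i, (X i).trace

/-- A positive semidefinite element of a multimatrix algebra of total trace one. -/
def PiIsState {ι : Type} [Fintype ι] {A : ι → Type} [∀ i, Fintype (A i)]
    (ρ : (i : ι) → Mat (A i)) : Prop :=
  (∀ i, (ρ i).PosSemidef) ∧ ∑ i, (ρ i).trace = 1

/-- `N` is an entanglement-left inverse of `M : A ⊗ M_{h₁} → B` with respect to
the resource state `W`. -/
def PiEntLeftInv {m n h₁ h₂ : ℕ} {a : Fin m → ℕ} {b : Fin n → ℕ}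
    (M : ((i : Fin m) → Mat (Fin (a i) × Fin h₁)) →ₗ[ℂ] (j : Fin n) → Mat (Fin (b j)))
    (N : ((j : Fin n) → Mat (Fin (b j) × Fin h₂)) →ₗ[ℂ] (i : Fin m) → Mat (Fin (a i)))
    (W : Mat (Fin h₁ × Fin h₂)) : Prop :=
  ∀ x : (i : Fin m) → Mat (Fin (a i)),
    N (piAmplR (Fin h₂) M fun i => tensorState (x i) W) = x

/-- `N` is an entanglement-right inverse of `M` with respect to `W`. -/
def PiEntRightInv {m n h₁ h₂ : ℕ} {a : Fin m → ℕ} {b : Fin n → ℕ}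
    (M : ((i : Fin m) → Mat (Fin (a i) × Fin h₁)) →ₗ[ℂ] (j : Fin n) → Mat (Fin (b j)))
    (N : ((j : Fin n) → Mat (Fin (b j) × Fin h₂)) →ₗ[ℂ] (i : Fin m) → Mat (Fin (a i)))
    (W : Mat (Fin h₁ × Fin h₂)) : Prop :=
  ∀ y : (j : Fin n) → Mat (Fin (b j)),
    M (piAmplR (Fin h₁) N fun j => tensorState (y j) (swapState W)) = y

/-- `M` is entanglement-reversible with respect to `W`. -/
def PiEntReversible {m n h₁ h₂ : ℕ} {a : Fin m → ℕ} {b : Fin n → ℕ}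
    (M : ((i : Fin m) → Mat (Fin (a i) × Fin h₁)) →ₗ[ℂ] (j : Fin n) → Mat (Fin (b j)))
    (W : Mat (Fin h₁ × Fin h₂)) : Prop :=
  ∃ N : ((j : Fin n) → Mat (Fin (b j) × Fin h₂)) →ₗ[ℂ] (i : Fin m) → Mat (Fin (a i)),
    PiIsChannel N ∧ PiEntLeftInv M N W

/-- `M` is entanglement-invertible with respect to `W`. -/
def PiEntInvertible {m n h₁ h₂ : ℕ} {a : Fin m → ℕ} {b : Fin n → ℕ}
    (M : ((i : Fin m) → Mat (Fin (a i) × Fin h₁)) →ₗ[ℂ] (j : Fin n) → Mat (Fin (b j)))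
    (W : Mat (Fin h₁ × Fin h₂)) : Prop :=
  ∃ N : ((j : Fin n) → Mat (Fin (b j) × Fin h₂)) →ₗ[ℂ] (i : Fin m) → Mat (Fin (a i)),
    PiIsChannel N ∧ PiEntLeftInv M N W ∧ PiEntRightInv M N W

end EntInvPaper

noncomputable section
open Matrix Kronecker
open scoped ComplexOrder
namespace EntInvPaper

/-- A completely positive map has positive amplifications over every finite index type. -/
lemma PiIsCP.piAmplL_posSemidef {ι κ : Type} {A : ι → Type} {B : κ → Type}
    [∀ i, Fintype (A i)] [∀ j, Fintype (B j)]
    {Φ : ((i : ι) → Mat (A i)) →ₗ[ℂ] (j : κ) → Mat (B j)} (hΦ : PiIsCP Φ)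
    {t : Type} [Fintype t] (X : (i : ι) → Mat (t × A i)) (hX : ∀ i, (X i).PosSemidef) (j : κ) :
    (piAmplL t Φ X j).PosSemidef := by
  let e := Fintype.equivFin t
  have h := hΦ (Fintype.card t)
    (fun i => (X i).submatrix (Prod.map e.symm id) (Prod.map e.symm id))
    (fun i => (hX i).submatrix _) j
  convert h.submatrix (Prod.map e id) using 1
  ext p q
  simp [piAmplL]

/-- The partial trace over the first factor preserves positive semidefiniteness. -/
lemma ptraceFst_posSemidef {p t : Type} [Fintype p] {X : Mat (p × t)}
    (hX : X.PosSemidef) : (ptraceFst X).PosSemidef := by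
  have h : ptraceFst X = ∑ u : p, X.submatrix (fun s => (u, s)) (fun s => (u, s)) := by
    ext s s'
    simp [ptraceFst, Matrix.sum_apply]
  rw [h]
  exact Matrix.posSemidef_sum _ fun u _ => hX.submatrix _

open scoped MatrixOrder in
/-- A positive semidefinite `X` on `ℂ^p ⊗ ℂ^t` satisfies `X ≤ p • (1 ⊗ Tr₁ X)`. -/
lemma card_smul_one_kronecker_ptraceFst_sub_posSemidef {p t : Type} [Fintype p] [DecidableEq p]
    [Fintype t] {X : Mat (p × t)} (hX : X.PosSemidef) :
    ((Fintype.card p : ℂ) • ((1 : Mat p) ⊗ₖ ptraceFst X) - X).PosSemidef := by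
  classical
  have hT : ((Fintype.card p : ℂ) • ((1 : Mat p) ⊗ₖ ptraceFst X)).PosSemidef :=
    (Matrix.PosSemidef.one.kronecker (ptraceFst_posSemidef hX)).smul (by positivity)
  refine Matrix.PosSemidef.of_dotProduct_mulVec_nonneg (hT.isHermitian.sub hX.isHermitian)
    fun z => ?_
  obtain ⟨C, rfl⟩ : ∃ C : Mat (p × t), X = Cᴴ * C :=
    CStarAlgebra.nonneg_iff_eq_star_mul_self.1 hX.nonneg
  let c : (p × t) → p → p → ℂ := fun r u v => ∑ s, C r (u, s) * z (v, s)
  have hquad : star z ⬝ᵥ (Cᴴ * C) *ᵥ z = ((∑ r, ‖∑ u, c r u u‖ ^ 2 : ℝ) : ℂ) := by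
    rw [← Matrix.mulVec_mulVec, Matrix.dotProduct_mulVec, Matrix.vecMul_conjTranspose, star_star]
    simp only [dotProduct, Pi.star_apply, mulVec, c, Fintype.sum_prod_type]
    push_cast
    simp [← Complex.conj_mul']
  have htr : star z ⬝ᵥ ((1 : Mat p) ⊗ₖ ptraceFst (Cᴴ * C)) *ᵥ z
      = ((∑ r, ∑ v, ∑ u, ‖c r u v‖ ^ 2 : ℝ) : ℂ) := by
    push_cast
    simp only [← Complex.conj_mul', c, map_sum, map_mul, Finset.sum_mul_sum]
    rw [Finset.sum_comm]
    simp only [dotProduct, Pi.star_apply, mulVec, kroneckerMap_apply, ptraceFst, Matrix.of_apply,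
      Matrix.mul_apply, conjTranspose_apply, Matrix.one_apply, ite_mul, one_mul, zero_mul,
      Fintype.sum_prod_type (α₁ := p) (α₂ := t) (f := fun x => star (z x) * _)]
    refine Finset.sum_congr rfl fun v _ => ?_
    rw [Finset.sum_congr rfl fun r _ => Finset.sum_comm, Finset.sum_comm]
    refine Finset.sum_congr rfl fun s _ => ?_
    simp only [Fintype.sum_prod_type (α₁ := p) (α₂ := t) (f := fun x => ite (v = x.1) _ _)]
    rw [Finset.sum_comm]
    simp only [Finset.sum_ite_eq, Finset.mem_univ, if_true, Finset.mul_sum, Finset.sum_mul]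
    rw [Finset.sum_congr rfl fun r _ => Finset.sum_comm, Finset.sum_comm]
    refine Finset.sum_congr rfl fun s' _ => ?_
    rw [Finset.sum_comm]
    refine Finset.sum_congr rfl fun r _ => Finset.sum_congr rfl fun u _ => ?_
    simp only [Complex.star_def]
    ring
  rw [Matrix.sub_mulVec, dotProduct_sub, Matrix.smul_mulVec, dotProduct_smul, hquad, htr,
    smul_eq_mul, sub_nonneg]
  norm_cast
  rw [Finset.mul_sum]
  refine Finset.sum_le_sum fun r _ => ?_
  calc ‖∑ u, c r u u‖ ^ 2 ≤ (∑ u, ‖c r u u‖) ^ 2 := by gcongr; exact norm_sum_le _ _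
    _ ≤ Fintype.card p * ∑ u, ‖c r u u‖ ^ 2 := sq_sum_le_card_mul_sum_sq
    _ ≤ Fintype.card p * ∑ v, ∑ u, ‖c r u v‖ ^ 2 := by
      gcongr with v
      exact Finset.single_le_sum (f := fun u => ‖c r u v‖ ^ 2) (fun _ _ => by positivity)
        (Finset.mem_univ v)

/-- Each member `X j` of a family of positive semidefinite operators is bounded by
`dim (B j) • (1 ⊗ σ)`, where `σ` is the sum of the partial traces of the whole family. -/
lemma card_smul_one_kronecker_sub_posSemidef {κ t : Type} [Fintype κ] [DecidableEq κ] [Fintype t]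
    {B : κ → Type} [∀ j, Fintype (B j)] [∀ j, DecidableEq (B j)]
    {X : (j : κ) → Mat (B j × t)} (hX : ∀ j, (X j).PosSemidef) (j : κ) :
    ((Fintype.card (B j) : ℂ) • ((1 : Mat (B j)) ⊗ₖ ∑ l, ptraceFst (X l)) - X j).PosSemidef := by
  classical
  rw [← Finset.add_sum_erase _ _ (Finset.mem_univ j), Matrix.kronecker_add, smul_add,
    add_sub_right_comm]
  exact (card_smul_one_kronecker_ptraceFst_sub_posSemidef (hX j)).add
    ((Matrix.PosSemidef.one.kronecker
      (Matrix.posSemidef_sum _ fun l _ => ptraceFst_posSemidef (hX l))).smul (by positivity))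

/-- **Dimension bound for entanglement-reversible channels.** If a channel
`M : A ⊗ M_{h₁}(ℂ) → B` between multimatrix algebras is entanglement-reversible
with respect to some state `W`, then `dim A ≤ dim B`. -/
theorem entanglement_reversible_dim_bound
    {m n : ℕ} (a : Fin m → ℕ) (b : Fin n → ℕ)
    (ha : ∀ i, 1 ≤ a i) (hb : ∀ j, 1 ≤ b j)
    (h₁ h₂ : ℕ) (hh₁ : 1 ≤ h₁) (hh₂ : 1 ≤ h₂)
    (W : Mat (Fin h₁ × Fin h₂)) (hW : IsState W)
    (M : ((i : Fin m) → Mat (Fin (a i) × Fin h₁)) →ₗ[ℂ] (j : Fin n) → Mat (Fin (b j)))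
    (hM : PiIsChannel M) (hrev : PiEntReversible M W) :
    ∑ i, (a i) ^ 2 ≤ ∑ j, (b j) ^ 2 := by
  obtain ⟨N, hN, hinv⟩ := hrev
  let T : (j : Fin n) → Mat (Fin (b j) × Fin h₂) := fun j =>
    (b j : ℂ) • ((1 : Mat (Fin (b j))) ⊗ₖ ptraceFst W)
  have hTtrace : ∑ j, (T j).trace = ((∑ j, (b j) ^ 2 : ℕ) : ℂ) := by
    have hW₂ : (ptraceFst W).trace = 1 := by
      rw [← hW.2]
      simp only [Matrix.trace, ptraceFst, Matrix.diag_apply, Matrix.of_apply,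
        Fintype.sum_prod_type]
      exact Finset.sum_comm
    push_cast
    exact Finset.sum_congr rfl fun j _ => by
      simp [T, Matrix.trace_smul, Matrix.trace_kronecker, hW₂, pow_two]
  have hbound : ∀ i, ((a i : ℂ)) ^ 2 ≤ (N T i).trace := by
    intro i
    let E : Fin (a i) → Fin (a i) → (i' : Fin m) → Mat (Fin (a i')) := fun r r' =>
      Pi.single i (Matrix.single r r' 1)
    let X : (i' : Fin m) → Mat ((Fin (a i) × Fin h₂) × (Fin (a i') × Fin h₁)) := fun i' =>
      Matrix.of fun p q => E p.1.1 q.1.1 i' p.2.1 q.2.1 * W (p.2.2, p.1.2) (q.2.2, q.1.2)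
    have hX : ∀ i', (X i').PosSemidef := by
      intro i'
      by_cases h : i' = i
      · subst h
        let v : Fin (a i') × Fin (a i') → ℂ := fun p => if p.1 = p.2 then 1 else 0
        let f : (Fin (a i') × Fin h₂) × (Fin (a i') × Fin h₁) →
            (Fin (a i') × Fin (a i')) × (Fin h₁ × Fin h₂) :=
          fun p => ((p.1.1, p.2.1), (p.2.2, p.1.2))
        have hfac : X i' = (vecMulVec v (star v) ⊗ₖ W).submatrix f f := by
          ext p q
          simp [X, E, f, v, Matrix.single_apply, vecMulVec_apply, ite_and]
          split_ifs <;> rfl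
        rw [hfac]
        exact ((Matrix.posSemidef_vecMulVec_self_star v).kronecker hW.1).submatrix f
      · convert Matrix.PosSemidef.zero using 1
        ext p q
        simp [X, E, h]
    let Y : (j : Fin n) → Mat (Fin (b j) × (Fin (a i) × Fin h₂)) := fun j =>
      (piAmplL (Fin (a i) × Fin h₂) M X j).submatrix Prod.swap Prod.swap
    have hY : ∀ j, (Y j).PosSemidef := fun j => (hM.1.piAmplL_posSemidef X hX j).submatrix _
    have hYtrace : ∑ j, ptraceFst (Y j) = (1 : Mat (Fin (a i))) ⊗ₖ ptraceFst W := by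
      ext ⟨r, k⟩ ⟨r', k'⟩
      have h := hM.2 fun i' => Matrix.of fun x y => X i' ((r, k), x) ((r', k'), y)
      simp only [Matrix.trace, Matrix.diag_apply] at h
      simp only [Matrix.sum_apply, ptraceFst, Matrix.of_apply, Y, submatrix_apply, piAmplL,
        Prod.swap]
      rw [h]
      simp only [X, Matrix.of_apply, Fintype.sum_prod_type, ← Finset.sum_mul_sum]
      rw [Fintype.sum_eq_single i fun i' hi' => by simp [E, hi'], Finset.sum_congr rfl
        fun x _ => by rw [show E r r' i = Matrix.single r r' 1 from Pi.single_eq_same i _]]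
      simp [Matrix.single_apply, Matrix.one_apply, ite_and, eq_comm]
    let D : (j : Fin n) → Mat (Fin (a i) × (Fin (b j) × Fin h₂)) := fun j =>
      (1 : Mat (Fin (a i))) ⊗ₖ T j - (Y j).submatrix (fun p => (p.2.1, (p.1, p.2.2)))
        (fun p => (p.2.1, (p.1, p.2.2)))
    have hD : ∀ j, (D j).PosSemidef := by
      intro j
      have h := (card_smul_one_kronecker_sub_posSemidef hY j).submatrix
        (fun p : Fin (a i) × (Fin (b j) × Fin h₂) => (p.2.1, (p.1, p.2.2)))
      rw [hYtrace] at h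
      convert h using 1
      ext p q
      simp [D, T]
      ring
    have hslice : ∀ r r', N (fun j => Matrix.of fun x y => D j (r, x) (r', y))
        = (1 : Mat (Fin (a i))) r r' • N T - E r r' := by
      intro r r'
      rw [← hinv (E r r'), ← map_smul, ← map_sub]
      congr 1
    have hpos := (hN.1.piAmplL_posSemidef D hD i).dotProduct_mulVec_nonneg
      (fun p => if p.1 = p.2 then 1 else 0)
    simp only [dotProduct, mulVec, piAmplL, Matrix.of_apply, hslice, Fintype.sum_prod_type,
      Pi.sub_apply, Pi.smul_apply, Matrix.sub_apply, Matrix.smul_apply, smul_eq_mul] at hpos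
    simpa [E, Matrix.one_apply, Matrix.trace, pow_two] using hpos
  have hsum : ((∑ i, (a i) ^ 2 : ℕ) : ℂ) ≤ ((∑ j, (b j) ^ 2 : ℕ) : ℂ) := by
    rw [← hTtrace, ← hN.2 T]
    push_cast
    exact Finset.sum_le_sum fun i _ => hbound i
  exact_mod_cast hsum

end EntInvPaper
end
end
end
end
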